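/- Let T1 and T2 be two rooted (nonbinary) phylogenetic 𝒳-trees. Every agreement forest reported by applying allMulMAFs* to T1 and T2 is relevant, i.e., it contains no edge e such that contracting e still yields an agreement forest for T1 and T2. -/

import Mathlib

open scoped Classical

namespace Phylo

/-! ## Rooted multifurcating phylogenetic trees, encoded as laminar families of clusters.

A rooted (possibly multi-labeled) tree is identified with the family of clusters
(= sets of taxa below a node) of its nodes.  Leaves are the minimal clusters
("blocks"); in an ordinary phylogenetic tree all blocks are singletons, while the
trees manipulated by the algorithm may carry set labels (contracted cherries). -/

variable {β : Type} [DecidableEq β]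

/-- A cluster system: candidate representation of a rooted tree. -/
abbrev Clus (β : Type) := Finset (Finset β)

/-- Ground set (taxa set / label set `ℒ`) of a cluster system. -/
def grd (G : Clus β) : Finset β := G.sup id

/-- `A` is a block (leaf label) of `G`: a minimal cluster. -/
def IsBlock (G : Clus β) (A : Finset β) : Prop :=
  A ∈ G ∧ ∀ C ∈ G, C ⊆ A → C = A

/-- `G` is (the cluster system of) a rooted tree: a laminar family of nonempty
sets containing its ground set, in which every element lies in some block. -/
def IsTree (G : Clus β) : Prop :=
  G.Nonempty ∧ (∀ C ∈ G, C.Nonempty) ∧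
  (∀ C ∈ G, ∀ D ∈ G, C ⊆ D ∨ D ⊆ C ∨ Disjoint C D) ∧
  grd G ∈ G ∧
  (∀ x ∈ grd G, ∃ A, IsBlock G A ∧ x ∈ A)

/-- `D` is a child of `C` in `G` (a maximal proper subcluster). -/
def IsChild (G : Clus β) (D C : Finset β) : Prop :=
  D ∈ G ∧ C ∈ G ∧ D ⊂ C ∧ ∀ E ∈ G, D ⊆ E → E ⊂ C → E = D

/-- `C` is the cluster of the lowest common ancestor of `A` in `G`. -/
def IsLca (G : Clus β) (A C : Finset β) : Prop :=
  C ∈ G ∧ A ⊆ C ∧ ∀ D ∈ G, A ⊆ D → C ⊆ D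

/-- Every internal node has exactly two children. -/
def IsBin (G : Clus β) : Prop :=
  ∀ C ∈ G, ¬ IsBlock G C →
    ∃ D E, D ≠ E ∧ IsChild G D C ∧ IsChild G E C ∧
      ∀ D', IsChild G D' C → D' = D ∨ D' = E

/-- `G` is a rooted phylogenetic tree on taxa set `X` (all leaves are singletons,
bijectively labeled by `X`). -/
def IsPhylo (X : Finset β) (G : Clus β) : Prop :=
  IsTree G ∧ grd G = X ∧ ∀ x ∈ X, ({x} : Finset β) ∈ G

/-- `G'` is a refinement of `G`: `G` is obtained from `G'` by contracting edges
(removing internal clusters); leaves are untouched. -/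
def Refines (G' G : Clus β) : Prop :=
  G ⊆ G' ∧ ∀ A, IsBlock G' A ↔ IsBlock G A

/-- binary resolution of a tree. -/
def BinRes (G' G : Clus β) : Prop := Refines G' G ∧ IsBin G'

/-- Restriction `G|_A` of a tree to the taxa in `A` (suppression of degree-two
nodes happens automatically, since equal clusters are identified). -/
noncomputable def restr (G : Clus β) (A : Finset β) : Clus β :=
  (G.image (· ∩ A)).erase ∅

/-- The subtree of `G` rooted at the node with cluster `P`. -/
noncomputable def below (G : Clus β) (P : Finset β) : Clus β :=
  G.filter (fun E => E ⊆ P)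

/-- The tree `G` augmented by a new root whose extra child is a new leaf
labeled by `ρ`. -/
def aug (G : Clus β) (ρ : β) : Clus β :=
  insert {ρ} (insert (insert ρ (grd G)) G)

/-! ## Forests and (acyclic) agreement forests -/

/-- A forest on the taxa set `Y`: components are trees on disjoint taxa sets
covering `Y`. -/
def IsForestOn (Y : Finset β) (F : List (Clus β)) : Prop :=
  (∀ G ∈ F, IsTree G) ∧
  F.Pairwise (fun G H => Disjoint (grd G) (grd H)) ∧
  F.foldr (fun G s => grd G ∪ s) ∅ = Y

/-- The in-edge of the node with cluster `C` belongs to the minimal subtree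
`T(A)` of `T` spanning the taxa in `A`. -/
def EdgeInSpan (T : Clus β) (A C : Finset β) : Prop :=
  C ∈ T ∧ (A ∩ C).Nonempty ∧ ¬ A ⊆ C

/-- The node with cluster `C` belongs to the minimal subtree `T(A)` of `T`
spanning the taxa in `A`. -/
def NodeInSpan (T : Clus β) (A C : Finset β) : Prop :=
  C ∈ T ∧ (A ∩ C).Nonempty ∧ (¬ A ⊆ C ∨ IsLca T A C)

/-- Agreement forest for two already `ρ`-augmented trees `U1`, `U2`:
a forest on the common taxa set, each component a refinement of the
corresponding restrictions, one component containing `ρ`, and the spanned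
subtrees pairwise edge-disjoint in `U1` and in `U2`. -/
def IsAFρ (ρ : β) (U1 U2 : Clus β) (F : List (Clus β)) : Prop :=
  IsForestOn (grd U1) F ∧ grd U2 = grd U1 ∧
  (∀ G ∈ F, IsPhylo (grd G) G) ∧
  (∀ G ∈ F, Refines G (restr U1 (grd G)) ∧ Refines G (restr U2 (grd G))) ∧
  (∃ G ∈ F, ρ ∈ grd G) ∧
  F.Pairwise (fun G H => ∀ C, ¬ (EdgeInSpan U1 (grd G) C ∧ EdgeInSpan U1 (grd H) C)) ∧
  F.Pairwise (fun G H => ∀ C, ¬ (EdgeInSpan U2 (grd G) C ∧ EdgeInSpan U2 (grd H) C))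

/-- Agreement forest for two rooted phylogenetic `X`-trees `T1`, `T2`
(each first augmented by the new taxon `ρ ∉ X`). -/
def IsAF (X : Finset β) (ρ : β) (T1 T2 : Clus β) (F : List (Clus β)) : Prop :=
  IsAFρ ρ (aug T1 ρ) (aug T2 ρ) F

/-- Maximum agreement forest: agreement forest of minimum size. -/
def IsMAF (X : Finset β) (ρ : β) (T1 T2 : Clus β) (F : List (Clus β)) : Prop :=
  IsAF X ρ T1 T2 F ∧ ∀ F', IsAF X ρ T1 T2 F' → F.length ≤ F'.length

/-- `F'` is obtained from `F` by contracting one edge of one component. -/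
def ContractEdgeF (F F' : List (Clus β)) : Prop :=
  ∃ l1 G l2 C, F = l1 ++ G :: l2 ∧ C ∈ G ∧ C ≠ grd G ∧ ¬ IsBlock G C ∧
    F' = l1 ++ G.erase C :: l2

/-- `F` is relevant: no single edge contraction yields again an agreement forest. -/
def RelevantFor (X : Finset β) (ρ : β) (T1 T2 : Clus β) (F : List (Clus β)) : Prop :=
  ∀ F', ContractEdgeF F F' → ¬ IsAF X ρ T1 T2 F'

def IsRelMAF (X : Finset β) (ρ : β) (T1 T2 : Clus β) (F : List (Clus β)) : Prop :=
  IsMAF X ρ T1 T2 F ∧ RelevantFor X ρ T1 T2 F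

/-- Edge of the ancestor-descendant graph `AG(T1,T2,F)`. -/
def AGEdge (ρ : β) (T1 T2 : Clus β) (F : List (Clus β)) (G H : Clus β) : Prop :=
  G ∈ F ∧ H ∈ F ∧ grd G ≠ grd H ∧
  ((∃ C D E, IsLca (aug T1 ρ) (grd G) C ∧ IsLca (aug T1 ρ) (grd H) D ∧
      D ⊆ E ∧ E ⊂ C ∧ EdgeInSpan (aug T1 ρ) (grd G) E) ∨
   (∃ C D E, IsLca (aug T2 ρ) (grd G) C ∧ IsLca (aug T2 ρ) (grd H) D ∧
      D ⊆ E ∧ E ⊂ C ∧ EdgeInSpan (aug T2 ρ) (grd G) E))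

/-- Acyclic agreement forest. -/
def IsAcyclicAF (X : Finset β) (ρ : β) (T1 T2 : Clus β) (F : List (Clus β)) : Prop :=
  IsAF X ρ T1 T2 F ∧ ∀ G, ¬ Relation.TransGen (AGEdge ρ T1 T2 F) G G

/-- Maximum acyclic agreement forest. -/
def IsMAAF (X : Finset β) (ρ : β) (T1 T2 : Clus β) (F : List (Clus β)) : Prop :=
  IsAcyclicAF X ρ T1 T2 F ∧ ∀ F', IsAcyclicAF X ρ T1 T2 F' → F.length ≤ F'.length

def IsRelMAAF (X : Finset β) (ρ : β) (T1 T2 : Clus β) (F : List (Clus β)) : Prop :=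
  IsMAAF X ρ T1 T2 F ∧ RelevantFor X ρ T1 T2 F

/-! ## Rooted phylogenetic networks and the hybridization number -/

/-- A finite rooted digraph with (partially) labeled vertices. -/
structure Net (β : Type) where
  n : ℕ
  edges : Finset (Fin n × Fin n)
  root : Fin n
  lab : Fin n → Option β

def Net.rel (N : Net β) (u v : Fin N.n) : Prop := (u, v) ∈ N.edges

/-- `N` is a rooted phylogenetic network on `X`: acyclic, rooted, leaves
(out-degree 0 nodes) bijectively labeled by `X`, no node with in- and
out-degree one. -/
def Net.IsPhyloNet (N : Net β) (X : Finset β) : Prop :=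
  (∀ v, ¬ Relation.TransGen N.rel v v) ∧
  (∀ v, Relation.ReflTransGen N.rel N.root v) ∧
  (∀ v, (∀ w, ¬ N.rel v w) ↔ (∃ x ∈ X, N.lab v = some x)) ∧
  (∀ v w, N.lab v ≠ none → N.lab v = N.lab w → v = w) ∧
  (∀ x ∈ X, ∃ v, N.lab v = some x) ∧
  (∀ v, ¬ ((∃! u, N.rel u v) ∧ (∃! w, N.rel v w)))

/-- The reticulation number `r(N) = |E| - |V| + 1` of a network. -/
def Net.ret (N : Net β) : ℕ := N.edges.card + 1 - N.n

/-- `N` displays (a refinement of) the tree `T`: there is a subgraph `E'` in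
which every vertex has in-degree at most one, together with an embedding `f`
of the clusters of `T` such that parent/child clusters are connected by
directed `E'`-paths, leaves carry the correct labels, and reachability in
`E'` respects clusters. -/
def Net.Displays (N : Net β) (T : Clus β) : Prop :=
  ∃ E' : Fin N.n → Fin N.n → Prop,
    (∀ u v, E' u v → N.rel u v) ∧
    (∀ v u u', E' u v → E' u' v → u = u') ∧
    ∃ f : Finset β → Fin N.n,
      Relation.ReflTransGen E' N.root (f (grd T)) ∧
      (∀ C D, IsChild T D C → Relation.TransGen E' (f C) (f D)) ∧
      (∀ x ∈ grd T, N.lab (f {x}) = some x) ∧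
      (∀ C ∈ T, ∀ x ∈ grd T, Relation.ReflTransGen E' (f C) (f {x}) → x ∈ C)

/-- The hybridization number `h(T1,T2)`: the minimum reticulation number of a
rooted phylogenetic network on `X` displaying refinements of both trees. -/
noncomputable def hyb (X : Finset β) (T1 T2 : Clus β) : ℕ :=
  sInf { r | ∃ N : Net β, N.IsPhyloNet X ∧ N.Displays T1 ∧ N.Displays T2 ∧ N.ret = r }


/-! ## The machinery of the algorithms allMulMAFs, allMulMAFs*, ProcessCherries -/

/-- The map `M` used for undoing cherry contractions: it maps a taxa set to
`(X₁, X₂, B)` where `B : Bool` records `⊤`/`⊥`. -/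
abbrev MapT (β : Type) := Finset β → Option (Finset β × Finset β × Bool)

/-- A state of the algorithm: the tree `R`, the forest `F`, and the map `M`. -/
abbrev St (β : Type) := Clus β × List (Clus β) × MapT β

/-- Re-map the entry of `A` in `M` to `⊥`. -/
noncomputable def remapBot (M : MapT β) (A : Finset β) : MapT β :=
  fun S => if S = A then (M S).map (fun p => (p.1, p.2.1, false)) else M S

/-- Conditionally re-map the entry of `A` in `M` to `⊥`. -/
noncomputable def remapIf (c : Prop) (A : Finset β) (M : MapT β) : MapT β :=
  fun S => if S = A ∧ c then (M S).map (fun p => (p.1, p.2.1, false)) else M S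

/-- Replace one occurrence of the component `G` in the forest by `new`. -/
def ReplaceIn (F F' : List (Clus β)) (G : Clus β) (new : List (Clus β)) : Prop :=
  ∃ l1 l2, F = l1 ++ G :: l2 ∧ F' = l1 ++ new ++ l2

/-- Remove the leaf with label `A` from `R` (suppressing its parent). -/
noncomputable def rmBlock (R : Clus β) (A : Finset β) : Clus β :=
  restr R (grd R \ A)

/-- Contract the cherry `{A, C}` (in either of the two ways of the paper;
in the cluster representation both coincide). -/
def conCh (G : Clus β) (A C : Finset β) : Clus β :=
  insert (A ∪ C) ((G.erase A).erase C)

def AllChildrenBlocks (G : Clus β) (P : Finset β) : Prop :=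
  ∀ D, IsChild G D P → IsBlock G D

/-- `{A, C}` is a cherry of `R`: two leaves with a common parent all of whose
children are leaves. -/
def CherryR (R : Clus β) (A C : Finset β) : Prop :=
  A ≠ C ∧ ∃ P, IsChild R A P ∧ IsChild R C P ∧ AllChildrenBlocks R P

/-- `{A, C}` is a cherry contained in the tree `G`. -/
def CherryOf (G : Clus β) (A C : Finset β) : Prop :=
  A ≠ C ∧ IsBlock G A ∧ IsBlock G C ∧ ∃ P, IsChild G A P ∧ IsChild G C P

def CherryF (F : List (Clus β)) (A C : Finset β) : Prop := ∃ G ∈ F, CherryOf G A C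

/-- common cherry of `R` and `F`. -/
def IsCommon (R : Clus β) (F : List (Clus β)) (A C : Finset β) : Prop :=
  CherryR R A C ∧ CherryF F A C

/-- contradicting cherry of `R` and `F`. -/
def IsContra (R : Clus β) (F : List (Clus β)) (A C : Finset β) : Prop :=
  CherryR R A C ∧ ¬ CherryF F A C

/-- Leaf `A` of `R` refers to an isolated node of `F`. -/
def IsolRef (R : Clus β) (F : List (Clus β)) (A : Finset β) : Prop :=
  IsBlock R A ∧ ({A} : Clus β) ∈ F

/-- `P` has at least three children in `G`. -/
def Deg3 (G : Clus β) (P : Finset β) : Prop :=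
  ∃ D1 D2 D3, IsChild G D1 P ∧ IsChild G D2 P ∧ IsChild G D3 P ∧
    D1 ≠ D2 ∧ D1 ≠ D3 ∧ D2 ≠ D3

/-- Processing a common cherry (Case 2 of allMulMAFs): contract `{A,C}` in `R`
and in its component of `F`, and record the contraction in `M` (with `⊤` iff
both parents are multifurcating). -/
def ConApply (s : St β) (A C : Finset β) (t : St β) : Prop :=
  IsCommon s.1 s.2.1 A C ∧
  ∃ G F', G ∈ s.2.1 ∧ CherryOf G A C ∧ ReplaceIn s.2.1 F' G [conCh G A C] ∧
  ∃ PR PG, IsChild s.1 A PR ∧ IsChild G A PG ∧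
  ∃ b : Bool, ((b = true) ↔ (Deg3 s.1 PR ∧ Deg3 G PG)) ∧
    t = (conCh s.1 A C, F', Function.update s.2.2 (A ∪ C) (some (A, C, b)))

/-- The update of `M` when cutting the in-edge of the leaf `A` in its
component `G` (Case 3a of allMulMAFs). -/
def CutUpd (G : Clus β) (A : Finset β) (M M' : MapT β) : Prop :=
  (∃ P D, IsChild G A P ∧ IsChild G D P ∧ D ≠ A ∧
      (∀ E, IsChild G E P → E = A ∨ E = D) ∧ IsBlock G D ∧ M' = remapBot M D) ∨
  ((¬ ∃ P D, IsChild G A P ∧ IsChild G D P ∧ D ≠ A ∧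
      (∀ E, IsChild G E P → E = A ∨ E = D) ∧ IsBlock G D) ∧ M' = M)

/-- Cut the in-edge `e_A` of the leaf labeled `A` of a contradicting cherry
`{A, C}` in the forest. -/
def CutApply (s : St β) (A C : Finset β) (t : St β) : Prop :=
  IsContra s.1 s.2.1 A C ∧
  ∃ G F' M', G ∈ s.2.1 ∧ IsBlock G A ∧
    ReplaceIn s.2.1 F' G [({A} : Clus β), restr G (grd G \ A)] ∧
    CutUpd G A s.2.2 M' ∧ t = (s.1, F', M')

/-- `D` is a node on the path connecting the leaves `A` and `C` in `G`. -/
def PathNode (G : Clus β) (A C D : Finset β) : Prop :=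
  D ∈ G ∧ D ≠ A ∧ D ≠ C ∧
  ((A ⊆ D ∧ ¬ C ⊆ D) ∨ (C ⊆ D ∧ ¬ A ⊆ D) ∨ IsLca G (A ∪ C) D)

/-- `E` is the maximal cluster of `G` below `D` containing `A`. -/
def IsMaxSub (G : Clus β) (A D E : Finset β) : Prop :=
  E ∈ G ∧ A ⊆ E ∧ E ⊂ D ∧ ∀ E' ∈ G, A ⊆ E' → E' ⊂ D → E' ⊆ E

/-- `P` is the ground set of the (grouped) pendant subtree hanging off the
path node `D` of the path connecting `A` and `C`. -/
def PendGround (G : Clus β) (A C D P : Finset β) : Prop :=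
  PathNode G A C D ∧
  ((A ⊆ D ∧ ¬ C ⊆ D ∧ ∃ E, IsMaxSub G A D E ∧ P = D \ E) ∨
   (C ⊆ D ∧ ¬ A ⊆ D ∧ ∃ E, IsMaxSub G C D E ∧ P = D \ E) ∨
   (IsLca G (A ∪ C) D ∧ ∃ E1 E2, IsMaxSub G A D E1 ∧ IsMaxSub G C D E2 ∧
      P = D \ (E1 ∪ E2)))

/-- The (grouped) pendant component with ground set `P`. -/
noncomputable def pendComp (G : Clus β) (P : Finset β) : Clus β :=
  insert P (below G P)

/-- The component still containing `A` and `C` after cutting all pendant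
edges of the `A`–`C` path (`L` = lca of `{A, C}`). -/
noncomputable def acComp (G : Clus β) (A C L : Finset β) : Clus β :=
  (G.image (fun D => D \ (L \ (A ∪ C)))).erase ∅

/-- Cutting the set `E_B` of pendant edges of `F[A ∼ C]`: the component `G`
is replaced by the `A`–`C` component together with all grouped pendant
components. -/
def CutPend (G : Clus β) (A C : Finset β) (out : List (Clus β)) : Prop :=
  ∃ L, IsLca G (A ∪ C) L ∧
  ∃ pend : List (Clus β),
    (∀ Q ∈ pend, ∃ D P, PendGround G A C D P ∧ P.Nonempty ∧ Q = pendComp G P) ∧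
    (∀ D P, PendGround G A C D P → P.Nonempty → pendComp G P ∈ pend) ∧
    pend.Nodup ∧ out = acComp G A C L :: pend

/-- The update of `M` in Case 3b of allMulMAFs. -/
def PendUpd (G : Clus β) (A C : Finset β) (M M' : MapT β) : Prop :=
  ∃ PA PC L, IsChild G A PA ∧ IsChild G C PC ∧ IsLca G (A ∪ C) L ∧
    M' = remapIf (PA ≠ L) A (remapIf (PC ≠ L) C M)

/-- Case 3b (third branch) of allMulMAFs: cut all pendant edges of
`F[A ∼ C]`. -/
def PendApply (s : St β) (A C : Finset β) (t : St β) : Prop :=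
  IsContra s.1 s.2.1 A C ∧
  ∃ G new F' M', G ∈ s.2.1 ∧ IsBlock G A ∧ IsBlock G C ∧
    CutPend G A C new ∧ ReplaceIn s.2.1 F' G new ∧
    PendUpd G A C s.2.2 M' ∧ t = (s.1, F', M')

/-- One expansion step of a contracted cherry, as prescribed by `M`
(`b = false` is `⊥`, `b = true` is `⊤`). -/
def ExpandStep (M : MapT β) (F F' : List (Clus β)) : Prop :=
  ∃ G A X1 X2 b, IsBlock G A ∧ M A = some (X1, X2, b) ∧
    ReplaceIn F F' G
      [if b then insert X1 (insert X2 (G.erase A)) else insert X1 (insert X2 G)]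

/-- Exhaustively expand the forest `F` as prescribed in `M`. -/
def Expands (M : MapT β) (F F' : List (Clus β)) : Prop :=
  Relation.ReflTransGen (ExpandStep M) F F' ∧
  ∀ G ∈ F', ∀ A, IsBlock G A → M A = none

/-- `R` consists of a single leaf. -/
def SingleLeaf (R : Clus β) : Prop := ∃ A, R = ({A} : Clus β)

/-- Case 1c of allMulMAFs: remove a leaf of `R` referring to an isolated node
of `F`. -/
def IsolApply (s : St β) (A : Finset β) (t : St β) : Prop :=
  IsolRef s.1 s.2.1 A ∧ t = (rmBlock s.1 A, s.2.1, remapBot s.2.2 A)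

/-- One recursive call of the algorithm allMulMAFs (Cases 1c, 2, 3a, 3b),
with the priority of the cases as in the paper and the abort conditions of
Cases 1a/1b as guards. -/
def AMFStep (k : ℕ) (s t : St β) : Prop :=
  s.2.1.length ≤ k ∧ ¬ SingleLeaf s.1 ∧
  ((∃ A, IsolApply s A t) ∨
   ((¬ ∃ A, IsolRef s.1 s.2.1 A) ∧ ∃ A C, ConApply s A C t) ∨
   ((¬ ∃ A, IsolRef s.1 s.2.1 A) ∧ (¬ ∃ A C, IsCommon s.1 s.2.1 A C) ∧
     ∃ A C, (CutApply s A C t ∨ PendApply s A C t)))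

/-- The initial state: `R = T1`, `F = {T2}` (both `ρ`-augmented), `M = ∅`. -/
def initSt (T1 T2 : Clus β) (ρ : β) : St β :=
  (aug T1 ρ, [aug T2 ρ], fun _ => none)

/-- `out` is one of the forests returned by `allMulMAFs(T1, {T2}, ∅, k)`. -/
def AMFRun (T1 T2 : Clus β) (ρ : β) (k : ℕ) (out : List (Clus β)) : Prop :=
  ∃ s : St β, Relation.ReflTransGen (AMFStep k) (initSt T1 T2 ρ) s ∧
    SingleLeaf s.1 ∧ s.2.1.length ≤ k ∧ Expands s.2.2 s.2.1 out

/-- allMAFs¹ = allMAAFs¹ of Albrecht (2015) without the acyclicity check; by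
Remark 2 of the paper, on binary input trees it processes cherries exactly as
allMulMAFs does. -/
def allMAFs1Run (T1 T2 : Clus β) (ρ : β) (k : ℕ) (out : List (Clus β)) : Prop :=
  AMFRun T1 T2 ρ k out

/-! ### allMulMAFs*: pseudo cherries and preparation -/

/-- proper leaf of `R` and `F`: its counterpart in `F` is a child of a root. -/
def ProperLeaf (R : Clus β) (F : List (Clus β)) (A : Finset β) : Prop :=
  IsBlock R A ∧ ∃ G ∈ F, IsChild G A (grd G)

/-- The leaves of `R` lying below `D`. -/
noncomputable def blocksIn (R : Clus β) (D : Finset β) : Finset (Finset β) :=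
  R.filter (fun E => IsBlock R E ∧ E ⊆ D)

/-- pseudo cherry `{A, C}` for `R` and `F`. -/
def PseudoCherry (R : Clus β) (F : List (Clus β)) (A C : Finset β) : Prop :=
  IsBlock R A ∧ IsBlock R C ∧ A ≠ C ∧
  ∃ L, IsLca R (A ∪ C) L ∧
    (∀ D, IsChild R D L →
      (blocksIn R D).card ≤ ((blocksIn R D).filter (fun B => ProperLeaf R F B)).card + 1) ∧
    (∃ B, ProperLeaf R F B ∧ B ⊆ L ∧ B ≠ A ∧ B ≠ C)

/-- `B` is a leaf pendant to the path connecting `A` and `C` in `R`. -/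
def PendantOnPath (R : Clus β) (A C B : Finset β) : Prop :=
  IsBlock R B ∧ B ≠ A ∧ B ≠ C ∧ ∃ P, IsChild R B P ∧ PathNode R A C P

/-- Cut the leaf labeled `B` out of its component of the forest. -/
def CutB (B : Finset β) (F F' : List (Clus β)) : Prop :=
  ∃ G, G ∈ F ∧ IsBlock G B ∧
    ReplaceIn F F' G [({B} : Clus β), restr G (grd G \ B)]

inductive CutsList : List (Finset β) → List (Clus β) → List (Clus β) → Prop
  | nil (F) : CutsList [] F F
  | cons (B l F F1 F') : CutB B F F1 → CutsList l F1 F' → CutsList (B :: l) F F'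

/-- Preparing a pseudo cherry `{A, C}`: all pendant proper leaves on the
`A`–`C` path are removed from `R`, cut in `F`, and re-mapped to `⊥` in `M`. -/
def Prep (s : St β) (A C : Finset β) (t : St β) : Prop :=
  ∃ l : List (Finset β), l.Nodup ∧
    (∀ B, B ∈ l ↔ (PendantOnPath s.1 A C B ∧ ProperLeaf s.1 s.2.1 B)) ∧
    ∃ F', CutsList l s.2.1 F' ∧
      t = (restr s.1 (grd s.1 \ l.foldr (· ∪ ·) ∅), F',
           l.foldr (fun B M => remapBot M B) s.2.2)

/-- Prepare `{A, C}` if it is a pseudo cherry; otherwise do nothing. -/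
def PrepOpt (s : St β) (A C : Finset β) (t : St β) : Prop :=
  (CherryR s.1 A C ∧ t = s) ∨ (PseudoCherry s.1 s.2.1 A C ∧ Prep s A C t)

/-- One recursive call of the modified algorithm allMulMAFs*. -/
def AMFSStep (k : ℕ) (s t : St β) : Prop :=
  s.2.1.length ≤ k ∧ ¬ SingleLeaf s.1 ∧
  ((∃ A, IsolApply s A t) ∨
   ((¬ ∃ A, IsolRef s.1 s.2.1 A) ∧
     ∃ A C s0, (CherryR s.1 A C ∨ PseudoCherry s.1 s.2.1 A C) ∧ PrepOpt s A C s0 ∧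
       (ConApply s0 A C t ∨ CutApply s0 A C t ∨ PendApply s0 A C t)))

/-- `out` is one of the forests returned by `allMulMAFs*(T1, {T2}, ∅, k)`. -/
def AMFSRun (T1 T2 : Clus β) (ρ : β) (k : ℕ) (out : List (Clus β)) : Prop :=
  ∃ s : St β, Relation.ReflTransGen (AMFSStep k) (initSt T1 T2 ρ) s ∧
    SingleLeaf s.1 ∧ s.2.1.length ≤ k ∧ Expands s.2.2 s.2.1 out

/-! ### ProcessCherries and cherry lists -/

/-- The four ways `∪_{ac}, ∤_a, ∤_c, ∩_{ac}` of processing a cherry. -/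
inductive Phi : Type
  | con : Phi
  | cutL : Phi
  | cutR : Phi
  | path : Phi

/-- A cherry action `Λᵢ = ({a, c}, φᵢ)`. -/
structure Act (β : Type) where
  A : Finset β
  C : Finset β
  phi : Phi

def RemIsolStep (s t : St β) : Prop := ∃ A, IsolApply s A t

/-- Exhaustively remove from `R` every leaf referring to an isolated node
of `F` (line 13 of Algorithm 1). -/
def RemIsolAll (s t : St β) : Prop :=
  Relation.ReflTransGen RemIsolStep s t ∧ ¬ ∃ A, IsolRef t.1 t.2.1 A

/-- One iteration of `ProcessCherries` on the cherry action `a` (returning a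
state rather than `∅`). -/
def PCStep (a : Act β) (s t : St β) : Prop :=
  (CherryR s.1 a.A a.C ∨ PseudoCherry s.1 s.2.1 a.A a.C) ∧
  ∃ s0, PrepOpt s a.A a.C s0 ∧
  ∃ s1, ((a.phi = Phi.con ∧ ConApply s0 a.A a.C s1) ∨
         (a.phi = Phi.cutL ∧ CutApply s0 a.A a.C s1) ∨
         (a.phi = Phi.cutR ∧ CutApply s0 a.C a.A s1) ∨
         (a.phi = Phi.path ∧ PendApply s0 a.A a.C s1)) ∧
  RemIsolAll s1 t

inductive PCRun : St β → List (Act β) → St β → Prop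
  | nil (s) : PCRun s [] s
  | cons (a l s s1 t) : PCStep a s s1 → PCRun s1 l t → PCRun s (a :: l) t

/-- `Λ` is a cherry list for `T1` and `T2`: `ProcessCherries(T1, {T2}, Λ)`
does not return `∅`. -/
def CherryList (T1 T2 : Clus β) (ρ : β) (Λ : List (Act β)) : Prop :=
  ∃ s, PCRun (initSt T1 T2 ρ) Λ s

/-- `out` is the forest returned by `ProcessCherries(T1, {T2}, Λ)` (after the
final expansion). -/
def PCOut (T1 T2 : Clus β) (ρ : β) (Λ : List (Act β)) (out : List (Clus β)) : Prop :=
  ∃ s, PCRun (initSt T1 T2 ρ) Λ s ∧ Expands s.2.2 s.2.1 out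

/-- every component of `Fh` is a binary resolution of a component of `F`. -/
def BinResF (Fh F : List (Clus β)) : Prop := ∀ Gh ∈ Fh, ∃ G ∈ F, BinRes Gh G

/-- pseudo binary resolution of a forest. -/
def PseudoBinResF (Fh F : List (Clus β)) : Prop :=
  ∀ Gh ∈ Fh, ∃ G ∈ F,
    BinRes Gh G ∨ ∃ D, IsChild G D (grd G) ∧ BinRes Gh (below G D)

/-! ### Trees reflecting a forest, the expanded ancestor-descendant graph,
exit nodes, and the refinement step of allMulMAAFs -/

/-- `U` is a tree reflecting the forest `F` with respect to `T`: a refinement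
of `T` in which the components of `F` embed as node-disjoint subtrees. -/
def Reflects (U T : Clus β) (F : List (Clus β)) : Prop :=
  Refines U T ∧
  (∀ G ∈ F, Refines G (restr U (grd G))) ∧
  F.Pairwise (fun G H => ∀ C, ¬ (NodeInSpan U (grd G) C ∧ NodeInSpan U (grd H) C))

/-- `φ⁻¹`: the node `v` of the reflecting tree `U` maps back to the node
`p.2` of the component `p.1` of `F`. -/
def PhiInv (U : Clus β) (F : List (Clus β)) (v : Finset β) (p : Clus β × Finset β) : Prop :=
  p.1 ∈ F ∧ v ∈ U ∧ NodeInSpan U (grd p.1) v ∧ p.2 = v ∩ grd p.1 ∧ p.2 ∈ p.1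

/-- Hybrid edge of `AG^ex` stemming from the reflecting tree `U`, pointing
from the node `x` to the root of the component `H`. -/
def HybEdgeT (U : Clus β) (F : List (Clus β)) (x : Clus β × Finset β) (H : Clus β) : Prop :=
  H ∈ F ∧ ∃ u v', IsLca U (grd H) u ∧ v' ∈ U ∧ u ⊂ v' ∧ PhiInv U F v' x ∧
    ∀ v'' ∈ U, u ⊂ v'' → (∃ q, PhiInv U F v'' q) → v' ⊆ v''

def Hyb1 (ρ : β) (U1 : Clus β) (F : List (Clus β)) (x y : Clus β × Finset β) : Prop :=
  ∃ H, H ∈ F ∧ ρ ∉ grd H ∧ y = (H, grd H) ∧ HybEdgeT U1 F x H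

/-- Edge of the expanded ancestor-descendant graph
`AG^ex(U1, U2, F)`: a tree edge inside a component or a hybrid edge. -/
def ExEdge (ρ : β) (U1 U2 : Clus β) (F : List (Clus β)) (x y : Clus β × Finset β) : Prop :=
  (x.1 ∈ F ∧ x.1 = y.1 ∧ IsChild x.1 y.2 x.2) ∨ Hyb1 ρ U1 F x y ∨ Hyb1 ρ U2 F x y

/-- Exit node of `AG^ex(U1, U2, F)`: the source of a hybrid edge on a directed
cycle whose preceding hybrid edge along the cycle stems from the other tree. -/
def IsExitNode (ρ : β) (U1 U2 : Clus β) (F : List (Clus β)) (v : Clus β × Finset β) : Prop :=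
  ∃ m : ℕ, 0 < m ∧ ∃ c : ZMod m → Clus β × Finset β,
    (∀ i, ExEdge ρ U1 U2 F (c i) (c (i + 1))) ∧
    ∃ i : ZMod m, c i = v ∧ ∃ d : ℕ, 0 < d ∧ d < m ∧
      ((Hyb1 ρ U1 F (c i) (c (i + 1)) ∧
          Hyb1 ρ U2 F (c (i - (d : ZMod m))) (c (i - (d : ZMod m) + 1))) ∨
       (Hyb1 ρ U2 F (c i) (c (i + 1)) ∧
          Hyb1 ρ U1 F (c (i - (d : ZMod m))) (c (i - (d : ZMod m) + 1)))) ∧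
      ∀ e : ℕ, 0 < e → e < d →
        (¬ Hyb1 ρ U1 F (c (i - (e : ZMod m))) (c (i - (e : ZMod m) + 1)) ∧
         ¬ Hyb1 ρ U2 F (c (i - (e : ZMod m))) (c (i - (e : ZMod m) + 1)))

/-- Ground set of the piece obtained at the chain node `E` when cutting every
edge on the path from the node `C` to the root of its component. -/
def ChainGround (G : Clus β) (C E P : Finset β) : Prop :=
  E ∈ G ∧ C ⊂ E ∧ ∃ E', IsMaxSub G C E E' ∧ P = E \ E'

/-- Fixing the exit node `(G, C)`: cut every edge on the path connecting `C`
with the root of `G`. -/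
def FixExit (G : Clus β) (C : Finset β) (out : List (Clus β)) : Prop :=
  ∃ pend : List (Clus β),
    (∀ Q ∈ pend, ∃ E P, ChainGround G C E P ∧ Q = pendComp G P) ∧
    (∀ E P, ChainGround G C E P → pendComp G P ∈ pend) ∧
    pend.Nodup ∧ out = below G C :: pend

/-- Fix one exit node of `AG^ex(U1, U2, F)` in the forest `F`. -/
def FixExitF (ρ : β) (U1 U2 : Clus β) (F F' : List (Clus β)) : Prop :=
  ∃ v, IsExitNode ρ U1 U2 F v ∧ ∃ out, FixExit v.1 v.2 out ∧ ReplaceIn F F' v.1 out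

/-- One round of the refinement step of allMulMAAFs: build reflecting trees
`T1(F)`, `T2(F)`, build `AG^ex`, and fix an exit node. -/
def RefStep (ρ : β) (T1 T2 : Clus β) (F F' : List (Clus β)) : Prop :=
  ∃ U1 U2, Reflects U1 (aug T1 ρ) F ∧ Reflects U2 (aug T2 ρ) F ∧ FixExitF ρ U1 U2 F F'

/-- `out` is one of the forests returned by `allMulMAAFs(T1, {T2}, ∅, k)`:
an agreement forest produced by allMulMAFs, refined by repeatedly fixing exit
nodes into an acyclic agreement forest of size at most `k`. -/
def AMAAFRun (T1 T2 : Clus β) (ρ : β) (k : ℕ) (out : List (Clus β)) : Prop :=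
  ∃ mid, AMFRun T1 T2 ρ k mid ∧
    Relation.ReflTransGen (fun F F' => RefStep ρ T1 T2 F F' ∧ F'.length ≤ k) mid out ∧
    out.length ≤ k ∧ (∀ G, ¬ Relation.TransGen (AGEdge ρ T1 T2 out) G G)

/-! ### Resolving and cutting -/

/-- componentwise refinement of a forest. -/
def ResolvesF (F F' : List (Clus β)) : Prop :=
  List.Forall₂ (fun G G' => Refines G' G) F F'

/-- Cut one edge (the in-edge of the node with cluster `C`) in one component. -/
def CutF (F F' : List (Clus β)) : Prop :=
  ∃ l1 G l2 C, F = l1 ++ G :: l2 ∧ C ∈ G ∧ C ≠ grd G ∧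
    F' = l1 ++ below G C :: restr G (grd G \ C) :: l2

/-- `F'` is obtained from `F` by first resolving some multifurcating nodes and
then cutting some edges. -/
def ObtainedRC (F F' : List (Clus β)) : Prop :=
  ∃ Fm, ResolvesF F Fm ∧ Relation.ReflTransGen CutF Fm F'

/-! ## Helper lemmas -/

theorem mem_grd' {G : Clus β} {x : β} : x ∈ grd G ↔ ∃ C ∈ G, x ∈ C := by
  simp [grd, Finset.mem_sup]

theorem sub_grd {G : Clus β} {C : Finset β} (h : C ∈ G) : C ⊆ grd G :=
  fun _ hx => mem_grd'.2 ⟨C, h, hx⟩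

/-- `A` is supported by `U1` or `U2` on the ground set `Y`, or is everything. -/
def Supp (U1 U2 : Clus β) (Y A : Finset β) : Prop :=
  A = Y ∨ (∃ D ∈ U1, A = D ∩ Y) ∨ (∃ D ∈ U2, A = D ∩ Y)

theorem Supp.inter {U1 U2 : Clus β} {Y A : Finset β} (h : Supp U1 U2 Y A) (S : Finset β) :
    Supp U1 U2 (Y ∩ S) (A ∩ S) := by
  rcases h with rfl | ⟨D, hD, rfl⟩ | ⟨D, hD, rfl⟩
  · exact Or.inl rfl
  · exact Or.inr (Or.inl ⟨D, hD, Finset.inter_assoc _ _ _⟩)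
  · exact Or.inr (Or.inr ⟨D, hD, Finset.inter_assoc _ _ _⟩)

theorem Supp.mono {U1 U2 : Clus β} {Y Y' A : Finset β} (h : Supp U1 U2 Y A)
    (h1 : A ⊆ Y') (h2 : Y' ⊆ Y) : Supp U1 U2 Y' A := by
  have := h.inter Y'
  rwa [Finset.inter_eq_left.2 h1, Finset.inter_eq_right.2 h2] at this

structure Good (U1 U2 G : Clus β) : Prop where
  ne : ∀ C ∈ G, C.Nonempty
  lam : ∀ C ∈ G, ∀ D ∈ G, C ⊆ D ∨ D ⊆ C ∨ Disjoint C D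
  cov : ∀ x ∈ grd G, ∃ A, IsBlock G A ∧ x ∈ A
  sup : ∀ C ∈ G, IsBlock G C ∨ Supp U1 U2 (grd G) C

variable {U1 U2 : Clus β}

/-- A block is contained in or disjoint from every cluster. -/
theorem Good.blk {G : Clus β} (h : Good U1 U2 G) {A C : Finset β} (hA : IsBlock G A)
    (hC : C ∈ G) : A ⊆ C ∨ Disjoint A C := by
  rcases h.lam A hA.1 C hC with h | h | h
  · exact Or.inl h
  · exact Or.inl (hA.2 C hC h).ge
  · exact Or.inr h

theorem Good.blk2 {G : Clus β} (h : Good U1 U2 G) {A C : Finset β} (hA : IsBlock G A)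
    (hC : IsBlock G C) (hne : A ≠ C) : Disjoint A C := by
  rcases h.blk hA hC.1 with h | h
  · exact absurd (hC.2 A hA.1 h) hne
  · exact h

theorem Good.restr {G : Clus β} (h : Good U1 U2 G) (S : Finset β)
    (hS : ∀ B, IsBlock G B → B ⊆ S ∨ Disjoint B S) :
    Good U1 U2 (restr G S) ∧ grd (restr G S) = grd G ∩ S := by
  have hm : ∀ E, E ∈ Phylo.restr G S ↔ E ≠ ∅ ∧ ∃ C ∈ G, C ∩ S = E := by
    intro E; simp [Phylo.restr]
  have hg : grd (Phylo.restr G S) = grd G ∩ S := by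
    ext x
    rw [mem_grd', Finset.mem_inter, mem_grd']
    constructor
    · rintro ⟨E, hE, hx⟩
      obtain ⟨_, C, hC, rfl⟩ := (hm E).1 hE
      rw [Finset.mem_inter] at hx
      exact ⟨⟨C, hC, hx.1⟩, hx.2⟩
    · rintro ⟨⟨C, hC, hx⟩, hxs⟩
      have hx' : x ∈ C ∩ S := Finset.mem_inter.2 ⟨hx, hxs⟩
      exact ⟨C ∩ S, (hm _).2 ⟨Finset.ne_empty_of_mem hx', C, hC, rfl⟩, hx'⟩
  have hb : ∀ B, IsBlock G B → B ⊆ S → IsBlock (Phylo.restr G S) B := by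
    intro B hB hBS
    refine ⟨(hm B).2 ⟨(h.ne B hB.1).ne_empty, B, hB.1, Finset.inter_eq_left.2 hBS⟩, ?_⟩
    intro E hE hEB
    obtain ⟨hne, C, hC, rfl⟩ := (hm E).1 hE
    rcases h.blk hB hC with h1 | h1
    · exact hEB.antisymm (Finset.subset_inter h1 hBS)
    · exfalso
      obtain ⟨x, hx⟩ := Finset.nonempty_iff_ne_empty.2 hne
      exact Finset.disjoint_left.1 h1 (hEB hx) (Finset.mem_inter.1 hx).1
  refine ⟨⟨?_, ?_, ?_, ?_⟩, hg⟩
  · intro C hC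
    exact Finset.nonempty_iff_ne_empty.2 ((hm C).1 hC).1
  · intro C hC D hD
    obtain ⟨_, C', hC', rfl⟩ := (hm C).1 hC
    obtain ⟨_, D', hD', rfl⟩ := (hm D).1 hD
    rcases h.lam C' hC' D' hD' with h | h | h
    · exact Or.inl (Finset.inter_subset_inter_right h)
    · exact Or.inr (Or.inl (Finset.inter_subset_inter_right h))
    · exact Or.inr (Or.inr (h.mono Finset.inter_subset_left Finset.inter_subset_left))
  · intro x hx
    rw [hg, Finset.mem_inter] at hx
    obtain ⟨A, hA, hxA⟩ := h.cov x hx.1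
    refine ⟨A, hb A hA ?_, hxA⟩
    rcases hS A hA with h | h
    · exact h
    · exact absurd hx.2 (Finset.disjoint_left.1 h hxA)
  · intro E hE
    obtain ⟨hne, C, hC, rfl⟩ := (hm E).1 hE
    rcases h.sup C hC with h1 | h1
    · left
      rcases hS C h1 with h2 | h2
      · rw [Finset.inter_eq_left.2 h2]; exact hb C h1 h2
      · exact absurd (Finset.disjoint_iff_inter_eq_empty.1 h2) hne
    · right
      rw [hg]
      exact h1.inter S

theorem Good.rmb {G : Clus β} (h : Good U1 U2 G) {A : Finset β} (hA : IsBlock G A) :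
    Good U1 U2 (Phylo.restr G (grd G \ A)) ∧ grd (Phylo.restr G (grd G \ A)) = grd G \ A := by
  have := h.restr (grd G \ A) (by
    intro B hB
    by_cases e : B = A
    · subst e; right; exact Finset.disjoint_sdiff
    · left
      rw [Finset.subset_sdiff]
      exact ⟨sub_grd hB.1, h.blk2 hB hA e⟩)
  refine ⟨this.1, this.2.trans ?_⟩
  exact Finset.inter_eq_right.2 Finset.sdiff_subset

theorem good_single {A : Finset β} (hA : A.Nonempty) :
    Good U1 U2 ({A} : Clus β) ∧ grd ({A} : Clus β) = A := by
  have hg : grd ({A} : Clus β) = A := by simp [grd]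
  have hb : IsBlock ({A} : Clus β) A := ⟨by simp, by simp⟩
  refine ⟨⟨by simpa using hA, by simp, ?_, ?_⟩, hg⟩
  · intro x hx; rw [hg] at hx; exact ⟨A, hb, hx⟩
  · intro C hC; rw [Finset.mem_singleton] at hC; subst hC; exact Or.inl hb

/-- unique parent -/
theorem Good.par {G : Clus β} (h : Good U1 U2 G) {A P E : Finset β} (hA : IsChild G A P)
    (hE : E ∈ G) (hAE : A ⊂ E) : P ⊆ E := by
  rcases h.lam P hA.2.1 E hE with h1 | h1 | h1
  · exact h1
  · rcases h1.eq_or_ssubset with h2 | h2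
    · exact h2.ge
    · exact absurd (hA.2.2.2 E hE hAE.1 h2) hAE.ne'
  · exfalso
    obtain ⟨x, hx⟩ := h.ne A hA.1
    exact Finset.disjoint_left.1 h1 (hA.2.2.1.1 hx) (hAE.1 hx)

/-- every element of a cluster properly containing `A` is in a child. -/
theorem Good.kid {G : Clus β} (h : Good U1 U2 G) {A P : Finset β} (hA : IsChild G A P)
    {x : β} (hx : x ∈ P) : ∃ D, IsChild G D P ∧ x ∈ D := by
  obtain ⟨B, hB, hxB⟩ := h.cov x (sub_grd hA.2.1 hx)
  have hBP : B ⊂ P := by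
    rcases h.blk hB hA.2.1 with h1 | h1
    · refine h1.ssubset_of_ne ?_
      rintro rfl
      exact hA.2.2.1.ne (hB.2 A hA.1 hA.2.2.1.1)
    · exact absurd hx (Finset.disjoint_left.1 h1 hxB)
  obtain ⟨D, hD, hmax⟩ := Finset.exists_max_image
    (G.filter (fun E => x ∈ E ∧ E ⊂ P)) Finset.card
    ⟨B, by simp [hB.1, hxB, hBP]⟩
  simp only [Finset.mem_filter] at hD hmax
  refine ⟨D, ⟨hD.1, hA.2.1, hD.2.2, ?_⟩, hD.2.1⟩
  intro E hE hDE hEP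
  exact (Finset.eq_of_subset_of_card_le hDE (hmax E ⟨hE, hDE hD.2.1, hEP⟩)).symm

theorem Good.two {G : Clus β} (h : Good U1 U2 G) {A C P : Finset β} (hA : IsChild G A P)
    (hC : IsChild G C P) (hne : A ≠ C) (hd : ¬ Deg3 G P) : P = A ∪ C := by
  apply Finset.Subset.antisymm
  · intro x hx
    obtain ⟨D, hD, hxD⟩ := h.kid hA hx
    by_contra hc
    rw [Finset.mem_union, not_or] at hc
    exact hd ⟨A, C, D, hA, hC, hD, hne, fun e => hc.1 (e ▸ hxD), fun e => hc.2 (e ▸ hxD)⟩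
  · exact Finset.union_subset hA.2.2.1.1 hC.2.2.1.1

theorem Good.con {G : Clus β} (h : Good U1 U2 G) {A C P : Finset β} (hA : IsChild G A P)
    (hC : IsChild G C P) (bA : IsBlock G A) (bC : IsBlock G C) :
    Good U1 U2 (conCh G A C) ∧ grd (conCh G A C) = grd G := by
  have hm : ∀ E, E ∈ conCh G A C ↔ E = A ∪ C ∨ (E ≠ C ∧ E ≠ A ∧ E ∈ G) := by
    intro E; simp [conCh]
  have hg : grd (conCh G A C) = grd G := by
    ext x
    rw [mem_grd', mem_grd']
    constructor
    · rintro ⟨E, hE, hx⟩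
      rcases (hm E).1 hE with rfl | h1
      · rcases Finset.mem_union.1 hx with h | h
        · exact ⟨A, hA.1, h⟩
        · exact ⟨C, hC.1, h⟩
      · exact ⟨E, h1.2.2, hx⟩
    · rintro ⟨E, hE, hx⟩
      by_cases e1 : E = A
      · exact ⟨A ∪ C, (hm _).2 (Or.inl rfl), Finset.mem_union_left _ (e1 ▸ hx)⟩
      by_cases e2 : E = C
      · exact ⟨A ∪ C, (hm _).2 (Or.inl rfl), Finset.mem_union_right _ (e2 ▸ hx)⟩
      exact ⟨E, (hm _).2 (Or.inr ⟨e2, e1, hE⟩), hx⟩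
  have hAC : A ∪ C ⊆ P := Finset.union_subset hA.2.2.1.1 hC.2.2.1.1
  have key : ∀ E ∈ G, E ≠ A → E ≠ C → A ∪ C ⊆ E ∨ Disjoint E (A ∪ C) := by
    intro E hE e1 e2
    rcases h.blk bA hE with h1 | h1
    · exact Or.inl (hAC.trans (h.par hA hE (h1.ssubset_of_ne (Ne.symm e1))))
    rcases h.blk bC hE with h2 | h2
    · exact Or.inl (hAC.trans (h.par hC hE (h2.ssubset_of_ne (Ne.symm e2))))
    · exact Or.inr (Finset.disjoint_union_right.2 ⟨h1.symm, h2.symm⟩)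
  have hACb : IsBlock (conCh G A C) (A ∪ C) := by
    refine ⟨(hm _).2 (Or.inl rfl), ?_⟩
    intro E hE hs
    rcases (hm E).1 hE with h1 | h1
    · exact h1
    · rcases key E h1.2.2 h1.2.1 h1.1 with h2 | h2
      · exact hs.antisymm h2
      · obtain ⟨x, hx⟩ := h.ne E h1.2.2
        exact absurd (hs hx) (Finset.disjoint_left.1 h2 hx)
  have hB : ∀ B, IsBlock G B → B ≠ A → B ≠ C → IsBlock (conCh G A C) B := by
    intro B hB e1 e2
    refine ⟨(hm _).2 (Or.inr ⟨e2, e1, hB.1⟩), ?_⟩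
    intro E hE hs
    rcases (hm E).1 hE with rfl | h1
    · exact absurd (hB.2 A hA.1 (Finset.subset_union_left.trans hs)).symm e1
    · exact hB.2 E h1.2.2 hs
  refine ⟨⟨?_, ?_, ?_, ?_⟩, hg⟩
  · intro E hE
    rcases (hm E).1 hE with rfl | h1
    · exact (h.ne A hA.1).mono Finset.subset_union_left
    · exact h.ne E h1.2.2
  · intro E hE D hD
    rcases (hm E).1 hE with rfl | h1 <;> rcases (hm D).1 hD with rfl | h2
    · exact Or.inl subset_rfl
    · rcases key D h2.2.2 h2.2.1 h2.1 with h3 | h3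
      · exact Or.inl h3
      · exact Or.inr (Or.inr h3.symm)
    · rcases key E h1.2.2 h1.2.1 h1.1 with h3 | h3
      · exact Or.inr (Or.inl h3)
      · exact Or.inr (Or.inr h3)
    · exact h.lam E h1.2.2 D h2.2.2
  · intro x hx
    rw [hg] at hx
    obtain ⟨B, hb, hxB⟩ := h.cov x hx
    by_cases e1 : B = A
    · exact ⟨_, hACb, Finset.mem_union_left _ (e1 ▸ hxB)⟩
    by_cases e2 : B = C
    · exact ⟨_, hACb, Finset.mem_union_right _ (e2 ▸ hxB)⟩
    exact ⟨B, hB B hb e1 e2, hxB⟩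
  · intro E hE
    rcases (hm E).1 hE with rfl | h1
    · exact Or.inl hACb
    · rw [hg]
      rcases h.sup E h1.2.2 with h2 | h2
      · exact Or.inl (hB E h2 h1.2.1 h1.1)
      · exact Or.inr h2

theorem Good.pend {G : Clus β} (h : Good U1 U2 G) {P : Finset β} (hP : P.Nonempty)
    (hPG : P ⊆ grd G) (hb : ∀ B, IsBlock G B → B ⊆ P ∨ Disjoint B P) :
    Good U1 U2 (pendComp G P) ∧ grd (pendComp G P) = P := by
  have hm : ∀ E, E ∈ pendComp G P ↔ E = P ∨ (E ∈ G ∧ E ⊆ P) := by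
    intro E; simp [pendComp, below]
  have hg : grd (pendComp G P) = P := by
    ext x
    rw [mem_grd']
    constructor
    · rintro ⟨E, hE, hx⟩
      rcases (hm E).1 hE with rfl | h1
      · exact hx
      · exact h1.2 hx
    · intro hx; exact ⟨P, (hm P).2 (Or.inl rfl), hx⟩
  have hB : ∀ B, IsBlock G B → B ⊆ P → IsBlock (pendComp G P) B := by
    intro B hB hs
    refine ⟨(hm B).2 (Or.inr ⟨hB.1, hs⟩), ?_⟩
    intro E hE hEB
    rcases (hm E).1 hE with rfl | h1
    · exact hEB.antisymm hs
    · exact hB.2 E h1.1 hEB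
  refine ⟨⟨?_, ?_, ?_, ?_⟩, hg⟩
  · intro E hE
    rcases (hm E).1 hE with rfl | h1
    · exact hP
    · exact h.ne E h1.1
  · intro E hE D hD
    rcases (hm E).1 hE with rfl | h1 <;> rcases (hm D).1 hD with rfl | h2
    · exact Or.inl subset_rfl
    · exact Or.inr (Or.inl h2.2)
    · exact Or.inl h1.2
    · exact h.lam E h1.1 D h2.1
  · intro x hx
    rw [hg] at hx
    obtain ⟨B, hb', hxB⟩ := h.cov x (hPG hx)
    refine ⟨B, hB B hb' ?_, hxB⟩
    rcases hb B hb' with h1 | h1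
    · exact h1
    · exact absurd hx (Finset.disjoint_left.1 h1 hxB)
  · intro E hE
    rw [hg]
    rcases (hm E).1 hE with rfl | h1
    · exact Or.inr (Or.inl rfl)
    · rcases h.sup E h1.1 with h2 | h2
      · exact Or.inl (hB E h2 h1.2)
      · exact Or.inr (h2.mono h1.2 hPG)

theorem good_aug {X : Finset β} {ρ : β} (hρ : ρ ∉ X) {T : Clus β} (h : IsPhylo X T)
    (hU : aug T ρ ⊆ U1 ∨ aug T ρ ⊆ U2) :
    Good U1 U2 (aug T ρ) ∧ grd (aug T ρ) = insert ρ X := by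
  obtain ⟨⟨_, hne, hl, hr, hc⟩, hX, hs⟩ := h
  have hm : ∀ E, E ∈ aug T ρ ↔ E = {ρ} ∨ E = insert ρ X ∨ E ∈ T := by
    intro E; simp [aug, hX]
  have hsub : ∀ E ∈ T, E ⊆ X := fun E hE => hX ▸ sub_grd hE
  have hg : grd (aug T ρ) = insert ρ X := by
    ext x
    rw [mem_grd']
    constructor
    · rintro ⟨E, hE, hx⟩
      rcases (hm E).1 hE with rfl | rfl | h1
      · simp at hx; simp [hx]
      · exact hx
      · exact Finset.mem_insert_of_mem (hsub E h1 hx)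
    · intro hx; exact ⟨_, (hm _).2 (Or.inr (Or.inl rfl)), hx⟩
  have hne' : ∀ E ∈ aug T ρ, E.Nonempty := by
    intro E hE
    rcases (hm E).1 hE with rfl | rfl | h1
    · simp
    · simp
    · exact hne E h1
  have hd : ∀ E ∈ T, Disjoint {ρ} E := by
    intro E hE
    rw [Finset.disjoint_singleton_left]
    exact fun h => hρ (hsub E hE h)
  refine ⟨⟨hne', ?_, ?_, ?_⟩, hg⟩
  · intro E hE D hD
    rcases (hm E).1 hE with rfl | rfl | h1 <;> rcases (hm D).1 hD with rfl | rfl | h2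
    · exact Or.inl subset_rfl
    · left; simp
    · exact Or.inr (Or.inr (hd D h2))
    · right; left; simp
    · exact Or.inl subset_rfl
    · exact Or.inr (Or.inl ((hsub D h2).trans (Finset.subset_insert _ _)))
    · exact Or.inr (Or.inr (hd E h1).symm)
    · exact Or.inl ((hsub E h1).trans (Finset.subset_insert _ _))
    · exact hl E h1 D h2
  · intro x hx
    rw [hg] at hx
    refine ⟨{x}, ⟨?_, ?_⟩, by simp⟩
    · rcases Finset.mem_insert.1 hx with rfl | h
      · exact (hm _).2 (Or.inl rfl)
      · exact (hm _).2 (Or.inr (Or.inr (hs x h)))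
    · intro E hE hEx
      rcases Finset.subset_singleton_iff.1 hEx with h | h
      · exact absurd h (hne' E hE).ne_empty
      · exact h
  · intro E hE
    right; right
    have : E = E ∩ grd (aug T ρ) := (Finset.inter_eq_left.2 (sub_grd hE)).symm
    rcases hU with hU | hU
    · exact Or.inl ⟨E, hU hE, this⟩
    · exact Or.inr ⟨E, hU hE, this⟩

theorem repl_spec {F F' : List (Clus β)} {G : Clus β} {new : List (Clus β)}
    (h : ReplaceIn F F' G new) (hg : ∀ H ∈ F, Good U1 U2 H)
    (hd : F.Pairwise (fun G H => Disjoint (grd G) (grd H)))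
    (hn : ∀ H ∈ new, Good U1 U2 H ∧ grd H ⊆ grd G)
    (hnd : new.Pairwise (fun G H => Disjoint (grd G) (grd H))) :
    (∀ H ∈ F', Good U1 U2 H) ∧ F'.Pairwise (fun G H => Disjoint (grd G) (grd H)) ∧
    (∀ H ∈ F', H ∈ new ∨ (H ∈ F ∧ Disjoint (grd H) (grd G))) ∧ (∀ H ∈ new, H ∈ F') ∧
    (∀ H ∈ F, H = G ∨ H ∈ F') := by
  obtain ⟨l1, l2, rfl, rfl⟩ := h
  simp only [List.pairwise_append, List.pairwise_cons, List.mem_cons, List.mem_append] at *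
  obtain ⟨p1, ⟨p2, p3⟩, p4⟩ := hd
  have q1 : ∀ H ∈ l1, Disjoint (grd H) (grd G) := fun H hH => p4 H hH G (Or.inl rfl)
  refine ⟨?_, ?_, ?_, ?_, ?_⟩
  · rintro H ((h | h) | h)
    · exact hg H (Or.inl h)
    · exact (hn H h).1
    · exact hg H (Or.inr (Or.inr h))
  · refine ⟨⟨p1, hnd, ?_⟩, p3, ?_⟩
    · intro a ha b hb
      exact (q1 a ha).mono_right (hn b hb).2
    · rintro a (ha | ha) b hb
      · exact p4 a ha b (Or.inr hb)
      · exact (p2 b hb).mono_left (hn a ha).2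
  · rintro H ((h | h) | h)
    · exact Or.inr ⟨Or.inl h, q1 H h⟩
    · exact Or.inl h
    · exact Or.inr ⟨Or.inr (Or.inr h), (p2 H h).symm⟩
  · intro H h; exact Or.inl (Or.inr h)
  · rintro H (h | h | h)
    · exact Or.inr (Or.inl (Or.inl h))
    · exact Or.inl h
    · exact Or.inr (Or.inr h)

theorem pw_disj {F : List (Clus β)} (hd : F.Pairwise (fun G H => Disjoint (grd G) (grd H)))
    {G H : Clus β} (hG : G ∈ F) (hH : H ∈ F) : G = H ∨ Disjoint (grd G) (grd H) := by
  by_cases e : G = H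
  · exact Or.inl e
  · have : Std.Symm (fun G H : Clus β => Disjoint (grd G) (grd H)) := ⟨fun _ _ h => h.symm⟩
    exact Or.inr (hd.forall hG hH e)

def BC (G : Clus β) (S : Finset β) : Prop := ∀ B, IsBlock G B → B ⊆ S ∨ Disjoint B S

theorem BC.sdiff {G : Clus β} {S T : Finset β} (hS : BC G S) (hT : BC G T) : BC G (S \ T) := by
  intro B hB
  rcases hS B hB with h1 | h1
  · rcases hT B hB with h2 | h2
    · right
      exact Finset.disjoint_left.2 fun x hx hx' => (Finset.mem_sdiff.1 hx').2 (h2 hx)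
    · left; exact Finset.subset_sdiff.2 ⟨h1, h2⟩
  · right; exact h1.mono_right Finset.sdiff_subset

theorem BC.union {G : Clus β} {S T : Finset β} (hS : BC G S) (hT : BC G T) : BC G (S ∪ T) := by
  intro B hB
  rcases hS B hB with h1 | h1
  · exact Or.inl (h1.trans Finset.subset_union_left)
  rcases hT B hB with h2 | h2
  · exact Or.inl (h2.trans Finset.subset_union_right)
  · exact Or.inr (Finset.disjoint_union_right.2 ⟨h1, h2⟩)

theorem Good.bc {G : Clus β} (h : Good U1 U2 G) {C : Finset β} (hC : C ∈ G) : BC G C :=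
  fun _ hB => h.blk hB hC

def Side (G : Clus β) (A C P : Finset β) : Prop :=
  ∃ D E, D ∈ G ∧ A ⊆ D ∧ ¬ C ⊆ D ∧ IsMaxSub G A D E ∧ P = D \ E

def TopP (G : Clus β) (A C P : Finset β) : Prop :=
  ∃ D E1 E2, IsLca G (A ∪ C) D ∧ IsMaxSub G A D E1 ∧ IsMaxSub G C D E2 ∧ P = D \ (E1 ∪ E2)

theorem pg_cases {G : Clus β} {A C D P : Finset β} (h : PendGround G A C D P) :
    Side G A C P ∨ Side G C A P ∨ TopP G A C P := by
  obtain ⟨hp, h⟩ := h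
  rcases h with ⟨h1, h2, E, h3, h4⟩ | ⟨h1, h2, E, h3, h4⟩ | ⟨h1, E1, E2, h2, h3, h4⟩
  · exact Or.inl ⟨D, E, hp.1, h1, h2, h3, h4⟩
  · exact Or.inr (Or.inl ⟨D, E, hp.1, h1, h2, h3, h4⟩)
  · exact Or.inr (Or.inr ⟨D, E1, E2, h1, h2, h3, h4⟩)

theorem disj_of_sub_of_sdiff {S T U P : Finset β} (h1 : P ⊆ T) (h2 : T ⊆ U) :
    Disjoint P (S \ U) :=
  Finset.disjoint_left.2 fun _ hx hx' => (Finset.mem_sdiff.1 hx').2 (h2 (h1 hx))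

theorem maxsub_uniq {G : Clus β} {A D E E' : Finset β} (h : IsMaxSub G A D E)
    (h' : IsMaxSub G A D E') : E = E' :=
  (h'.2.2.2 E h.1 h.2.1 h.2.2.1).antisymm (h.2.2.2 E' h'.1 h'.2.1 h'.2.2.1)

theorem Good.comp {G : Clus β} (h : Good U1 U2 G) {A D D' : Finset β} (hA : A.Nonempty)
    (hD : D ∈ G) (hD' : D' ∈ G) (h1 : A ⊆ D) (h2 : A ⊆ D') : D ⊆ D' ∨ D' ⊆ D := by
  rcases h.lam D hD D' hD' with h3 | h3 | h3
  · exact Or.inl h3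
  · exact Or.inr h3
  · obtain ⟨x, hx⟩ := hA
    exact absurd (h2 hx) (Finset.disjoint_left.1 h3 (h1 hx))

theorem side_side {G : Clus β} (h : Good U1 U2 G) {A C P P' : Finset β} (hA : A.Nonempty)
    (h1 : Side G A C P) (h2 : Side G A C P') : P = P' ∨ Disjoint P P' := by
  obtain ⟨D, E, hD, a1, a2, a3, rfl⟩ := h1
  obtain ⟨D', E', hD', b1, b2, b3, rfl⟩ := h2
  by_cases e : D = D'
  · subst e; left; rw [maxsub_uniq a3 b3]
  right
  rcases h.comp hA hD hD' a1 b1 with h3 | h3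
  · exact disj_of_sub_of_sdiff Finset.sdiff_subset
      (b3.2.2.2 D hD a1 (h3.ssubset_of_ne e))
  · exact (disj_of_sub_of_sdiff Finset.sdiff_subset
      (a3.2.2.2 D' hD' b1 (h3.ssubset_of_ne (Ne.symm e)))).symm

theorem side_opp {G : Clus β} (h : Good U1 U2 G) {A C P P' : Finset β}
    (h1 : Side G A C P) (h2 : Side G C A P') : Disjoint P P' := by
  obtain ⟨D, E, hD, a1, a2, a3, rfl⟩ := h1
  obtain ⟨D', E', hD', b1, b2, b3, rfl⟩ := h2
  rcases h.lam D hD D' hD' with h3 | h3 | h3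
  · exact absurd (a1.trans h3) b2
  · exact absurd (b1.trans h3) a2
  · exact h3.mono Finset.sdiff_subset Finset.sdiff_subset

theorem side_sub {G : Clus β} (h : Good U1 U2 G) {A C D L : Finset β} (hA : A.Nonempty)
    (hD : D ∈ G) (h1 : A ⊆ D) (h2 : ¬ C ⊆ D) (hL : L ∈ G) (hAL : A ⊆ L) (hCL : C ⊆ L) :
    D ⊂ L := by
  rcases h.comp hA hD hL h1 hAL with h3 | h3
  · refine h3.ssubset_of_ne ?_
    rintro rfl
    exact h2 hCL
  · exact absurd (hCL.trans h3) h2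

theorem side_top {G : Clus β} (h : Good U1 U2 G) {A C P P' : Finset β} (hA : A.Nonempty)
    (h1 : Side G A C P) (h2 : TopP G A C P') : Disjoint P P' := by
  obtain ⟨D, E, hD, a1, a2, a3, rfl⟩ := h1
  obtain ⟨L, E1, E2, hL, b1, b2, rfl⟩ := h2
  have := side_sub h hA hD a1 a2 hL.1 (Finset.union_subset_left hL.2.1)
    (Finset.union_subset_right hL.2.1)
  exact disj_of_sub_of_sdiff Finset.sdiff_subset
    ((b1.2.2.2 D hD a1 this).trans Finset.subset_union_left)

theorem topP_symm {G : Clus β} {A C P : Finset β} (h : TopP G A C P) : TopP G C A P := by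
  obtain ⟨L, E1, E2, hL, b1, b2, rfl⟩ := h
  exact ⟨L, E2, E1, by rwa [Finset.union_comm], b2, b1, by rw [Finset.union_comm]⟩

theorem lca_uniq {G : Clus β} {A D D' : Finset β} (h : IsLca G A D) (h' : IsLca G A D') :
    D = D' :=
  (h.2.2 D' h'.1 h'.2.1).antisymm (h'.2.2 D h.1 h.2.1)

theorem top_top {G : Clus β} {A C P P' : Finset β}
    (h1 : TopP G A C P) (h2 : TopP G A C P') : P = P' := by
  obtain ⟨D, E1, E2, hD, a1, a2, rfl⟩ := h1
  obtain ⟨D', E1', E2', hD', b1, b2, rfl⟩ := h2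
  obtain rfl := lca_uniq hD hD'
  rw [maxsub_uniq a1 b1, maxsub_uniq a2 b2]

theorem pg_disj {G : Clus β} (h : Good U1 U2 G) {A C D D' P P' : Finset β} (hA : A.Nonempty)
    (hC : C.Nonempty) (h1 : PendGround G A C D P) (h2 : PendGround G A C D' P') :
    P = P' ∨ Disjoint P P' := by
  rcases pg_cases h1 with h1 | h1 | h1 <;> rcases pg_cases h2 with h2 | h2 | h2
  · exact side_side h hA h1 h2
  · exact Or.inr (side_opp h h1 h2)
  · exact Or.inr (side_top h hA h1 h2)
  · exact Or.inr (side_opp h h1 h2)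
  · exact side_side h hC h1 h2
  · exact Or.inr (side_top h hC h1 (topP_symm h2))
  · exact Or.inr (side_top h hA h2 h1).symm
  · exact Or.inr (side_top h hC h2 (topP_symm h1)).symm
  · exact Or.inl (top_top h1 h2)

theorem side_info {G : Clus β} (h : Good U1 U2 G) {A C P L : Finset β} (hA : IsBlock G A)
    (hC : IsBlock G C) (hL : L ∈ G) (hAL : A ⊆ L) (hCL : C ⊆ L) (h1 : Side G A C P) :
    BC G P ∧ P ⊆ L \ (A ∪ C) := by
  obtain ⟨D, E, hD, a1, a2, a3, rfl⟩ := h1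
  refine ⟨(h.bc hD).sdiff (h.bc a3.1), ?_⟩
  have hs := side_sub h (h.ne A hA.1) hD a1 a2 hL hAL hCL
  have hd : Disjoint C D := (h.blk hC hD).resolve_left a2
  intro x hx
  rw [Finset.mem_sdiff] at hx
  rw [Finset.mem_sdiff, Finset.mem_union]
  refine ⟨hs.1 hx.1, ?_⟩
  rintro (hx' | hx')
  · exact hx.2 (a3.2.1 hx')
  · exact Finset.disjoint_left.1 hd hx' hx.1

theorem pg_info {G : Clus β} (h : Good U1 U2 G) {A C D P L : Finset β} (hA : IsBlock G A)
    (hC : IsBlock G C) (hL : IsLca G (A ∪ C) L) (h1 : PendGround G A C D P) :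
    BC G P ∧ P ⊆ L \ (A ∪ C) := by
  have hAL := Finset.union_subset_left hL.2.1
  have hCL := Finset.union_subset_right hL.2.1
  rcases pg_cases h1 with h1 | h1 | h1
  · exact side_info h hA hC hL.1 hAL hCL h1
  · rw [Finset.union_comm]; exact side_info h hC hA hL.1 hCL hAL h1
  · obtain ⟨L', E1, E2, hL', b1, b2, rfl⟩ := h1
    obtain rfl := lca_uniq hL hL'
    refine ⟨(h.bc hL.1).sdiff ((h.bc b1.1).union (h.bc b2.1)), ?_⟩
    exact Finset.sdiff_subset_sdiff subset_rfl (Finset.union_subset_union b1.2.1 b2.2.1)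

theorem acComp_eq {G : Clus β} {A C L : Finset β} :
    acComp G A C L = Phylo.restr G (grd G \ (L \ (A ∪ C))) := by
  unfold acComp Phylo.restr
  congr 1
  apply Finset.image_congr
  intro D hD
  have := sub_grd (Finset.mem_coe.1 hD)
  ext x
  simp only [Finset.mem_sdiff, Finset.mem_inter]
  constructor
  · rintro ⟨h1, h2⟩; exact ⟨h1, this h1, h2⟩
  · rintro ⟨h1, _, h2⟩; exact ⟨h1, h2⟩

theorem Good.ac {G : Clus β} (h : Good U1 U2 G) {A C L : Finset β} (hA : IsBlock G A)
    (hC : IsBlock G C) (hL : L ∈ G) :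
    Good U1 U2 (acComp G A C L) ∧ grd (acComp G A C L) = grd G \ (L \ (A ∪ C)) := by
  rw [acComp_eq]
  have hbc : BC G (grd G \ (L \ (A ∪ C))) :=
    BC.sdiff (fun B hB => Or.inl (sub_grd hB.1))
      ((h.bc hL).sdiff ((h.bc hA.1).union (h.bc hC.1)))
  obtain ⟨h1, h2⟩ := h.restr _ hbc
  exact ⟨h1, h2.trans (Finset.inter_eq_right.2 Finset.sdiff_subset)⟩

/-- the list produced by cutting pendant edges is fine -/
theorem cutPend_spec {G : Clus β} (h : Good U1 U2 G) {A C : Finset β} (hA : IsBlock G A)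
    (hC : IsBlock G C) {new : List (Clus β)} (hn : CutPend G A C new) :
    (∀ H ∈ new, Good U1 U2 H ∧ grd H ⊆ grd G) ∧
    new.Pairwise (fun G H => Disjoint (grd G) (grd H)) ∧
    (∀ L, IsLca G (A ∪ C) L → ∀ H ∈ new,
      grd H = grd G \ (L \ (A ∪ C)) ∨ Disjoint (A ∪ C) (grd H)) := by
  obtain ⟨L, hL, pend, hp1, -, hnd, rfl⟩ := hn
  obtain ⟨ac1, ac2⟩ := h.ac hA hC hL.1
  have hp : ∀ Q ∈ pend, ∃ D P, PendGround G A C D P ∧ Q = pendComp G P ∧ Good U1 U2 Q ∧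
      grd Q = P ∧ P ⊆ L \ (A ∪ C) := by
    intro Q hQ
    obtain ⟨D, P, a1, a2, rfl⟩ := hp1 Q hQ
    obtain ⟨b1, b2⟩ := pg_info h hA hC hL a1
    have := h.pend a2 (b2.trans (Finset.sdiff_subset.trans (sub_grd hL.1))) b1
    exact ⟨D, P, a1, rfl, this.1, this.2, b2⟩
  refine ⟨?_, ?_, ?_⟩
  · intro H hH
    rcases List.mem_cons.1 hH with rfl | hH
    · exact ⟨ac1, by rw [ac2]; exact Finset.sdiff_subset⟩
    · obtain ⟨D, P, a1, _, a3, a4, a5⟩ := hp H hH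
      exact ⟨a3, by rw [a4]; exact a5.trans (Finset.sdiff_subset.trans (sub_grd hL.1))⟩
  · rw [List.pairwise_cons]
    constructor
    · intro Q hQ
      obtain ⟨D, P, a1, _, a3, a4, a5⟩ := hp Q hQ
      rw [a4, ac2]
      exact Finset.sdiff_disjoint.mono_right a5
    · refine List.Pairwise.imp_of_mem ?_ hnd
      intro Q Q' hQ hQ' hne
      obtain ⟨D, P, a1, a2, a3, a4, a5⟩ := hp Q hQ
      obtain ⟨D', P', b1, b2, b3, b4, b5⟩ := hp Q' hQ'
      rw [a4, b4]
      rcases pg_disj h (h.ne A hA.1) (h.ne C hC.1) a1 b1 with e | e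
      · subst e; exact absurd (a2.trans b2.symm) hne
      · exact e
  · intro L' hL' H hH
    obtain rfl := lca_uniq hL hL'
    rcases List.mem_cons.1 hH with rfl | hH
    · exact Or.inl ac2
    · obtain ⟨D, P, a1, _, a3, a4, a5⟩ := hp H hH
      right
      rw [a4]
      exact Finset.disjoint_sdiff.mono_right a5

theorem pend_supp {G : Clus β} (h : Good U1 U2 G) {A C L PA : Finset β} (hA : IsBlock G A)
    (hC : IsBlock G C) (hne : A ≠ C) (hL : IsLca G (A ∪ C) L) (hP : IsChild G A PA)
    (hPL : PA ≠ L) : Supp U1 U2 (grd G \ (L \ (A ∪ C))) A := by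
  have hAL := Finset.union_subset_left hL.2.1
  have hCL := Finset.union_subset_right hL.2.1
  have hAL' : A ⊂ L := by
    refine hAL.ssubset_of_ne ?_
    rintro rfl
    exact hne (hA.2 C hC.1 hCL).symm
  have h1 : PA ⊆ L := h.par hP hL.1 hAL'
  have h2 : Disjoint C PA := by
    refine (h.blk hC hP.2.1).resolve_left ?_
    intro h3
    exact hPL (h1.antisymm (hL.2.2 PA hP.2.1 (Finset.union_subset hP.2.2.1.1 h3)))
  have hnb : ¬ IsBlock G PA := fun hb => hP.2.2.1.ne (hb.2 A hA.1 hP.2.2.1.1)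
  have h3 := ((h.sup PA hP.2.1).resolve_left hnb).inter (grd G \ (L \ (A ∪ C)))
  rw [Finset.inter_eq_right.2 Finset.sdiff_subset] at h3
  convert h3 using 1
  ext x
  simp only [Finset.mem_inter, Finset.mem_sdiff, Finset.mem_union]
  constructor
  · intro hx
    exact ⟨hP.2.2.1.1 hx, sub_grd hA.1 hx, fun h => h.2 (Or.inl hx)⟩
  · rintro ⟨hx, hx1, hx2⟩
    by_contra hc
    refine hx2 ⟨h1 hx, ?_⟩
    rintro (h | h)
    · exact hc h
    · exact Finset.disjoint_left.1 h2 h hx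

def MOk (M : MapT β) : Prop := ∀ S X1 X2 b, M S = some (X1, X2, b) →
  X1.Nonempty ∧ X2.Nonempty ∧ Disjoint X1 X2 ∧ S = X1 ∪ X2

def Bot (M : MapT β) (S : Finset β) : Prop := ∃ X1 X2, M S = some (X1, X2, false)

structure Inv (U1 U2 : Clus β) (s : St β) : Prop where
  gR : Good U1 U2 s.1
  gF : ∀ G ∈ s.2.1, Good U1 U2 G
  dis : s.2.1.Pairwise (fun G H => Disjoint (grd G) (grd H))
  sub : ∀ G ∈ s.2.1, (∃ B, G = {B}) ∨ grd G ⊆ grd s.1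
  m : MOk s.2.2
  mb : ∀ S, Bot s.2.2 S → ∀ G ∈ s.2.1, S ⊆ grd G → Supp U1 U2 (grd G) S

theorem mok_remapIf {c : Prop} {A : Finset β} {M : MapT β} (h : MOk M) :
    MOk (remapIf c A M) := by
  intro S X1 X2 b hS
  unfold remapIf at hS
  split_ifs at hS with hc
  · rw [Option.map_eq_some_iff] at hS
    obtain ⟨⟨a1, a2, a3⟩, h1, h2⟩ := hS
    simp only [Prod.mk.injEq] at h2
    obtain ⟨rfl, rfl, _⟩ := h2
    exact h S _ _ _ h1
  · exact h S _ _ _ hS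

theorem bot_remapIf {c : Prop} {A S : Finset β} {M : MapT β} (h : Bot (remapIf c A M) S) :
    Bot M S ∨ (S = A ∧ c) := by
  obtain ⟨X1, X2, hS⟩ := h
  unfold remapIf at hS
  split_ifs at hS with hc
  · exact Or.inr hc
  · exact Or.inl ⟨X1, X2, hS⟩

theorem remapBot_eq (M : MapT β) (A : Finset β) : remapBot M A = remapIf True A M := by
  funext S; simp [remapBot, remapIf]

theorem mok_remapBot {A : Finset β} {M : MapT β} (h : MOk M) : MOk (remapBot M A) := by
  rw [remapBot_eq]; exact mok_remapIf h

theorem bot_remapBot {A S : Finset β} {M : MapT β} (h : Bot (remapBot M A) S) :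
    Bot M S ∨ S = A := by
  rw [remapBot_eq] at h
  rcases bot_remapIf h with h | h
  · exact Or.inl h
  · exact Or.inr h.1

theorem not_single {G : Clus β} {A C : Finset β} (hA : A ∈ G) (hC : C ∈ G) (hne : A ≠ C) :
    ¬ ∃ B, G = {B} := by
  rintro ⟨B, rfl⟩
  rw [Finset.mem_singleton] at hA hC
  exact hne (hA.trans hC.symm)

theorem not_sub_disj {S Y Z : Finset β} (hS : S.Nonempty) (h1 : S ⊆ Y) (h2 : S ⊆ Z) :
    ¬ Disjoint Y Z := by
  intro hd
  obtain ⟨x, hx⟩ := hS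
  exact Finset.disjoint_left.1 hd (h1 hx) (h2 hx)

theorem inv_isol {s t : St β} {A : Finset β} (h : Inv U1 U2 s) (ha : IsolApply s A t) :
    Inv U1 U2 t := by
  obtain ⟨⟨hA, hF⟩, rfl⟩ := ha
  have hne := h.gR.ne A hA.1
  obtain ⟨r1, r2⟩ := h.gR.rmb hA
  have hs : grd ({A} : Clus β) = A := by simp [grd]
  refine ⟨r1, h.gF, h.dis, ?_, mok_remapBot h.m, ?_⟩
  · intro G hG
    rcases h.sub G hG with h1 | h1
    · exact Or.inl h1
    · rcases pw_disj h.dis hG hF with h2 | h2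
      · exact Or.inl ⟨A, h2⟩
      · right
        change grd G ⊆ grd (Phylo.restr s.1 (grd s.1 \ A))
        rw [r2, Finset.subset_sdiff]
        exact ⟨h1, hs ▸ h2⟩
  · intro S hS G hG hSG
    rcases bot_remapBot hS with h1 | rfl
    · exact h.mb S h1 G hG hSG
    · rcases pw_disj h.dis hG hF with h2 | h2
      · subst h2; rw [hs]; exact Or.inl rfl
      · rw [hs] at h2
        exact absurd h2 (not_sub_disj hne hSG subset_rfl)

/-- cutting a leaf -/
theorem cut_new {G : Clus β} (h : Good U1 U2 G) {A : Finset β} (hA : IsBlock G A) :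
    (∀ H ∈ [({A} : Clus β), Phylo.restr G (grd G \ A)], Good U1 U2 H ∧ grd H ⊆ grd G) ∧
    [({A} : Clus β), Phylo.restr G (grd G \ A)].Pairwise
      (fun G H => Disjoint (grd G) (grd H)) := by
  obtain ⟨s1, s2⟩ := good_single (U1 := U1) (U2 := U2) (h.ne A hA.1)
  obtain ⟨r1, r2⟩ := h.rmb hA
  constructor
  · intro H hH
    simp only [List.mem_cons, List.not_mem_nil, or_false] at hH
    rcases hH with rfl | rfl
    · exact ⟨s1, by rw [s2]; exact sub_grd hA.1⟩
    · exact ⟨r1, by rw [r2]; exact Finset.sdiff_subset⟩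
  · simp only [List.pairwise_cons, List.mem_cons, List.not_mem_nil, or_false, forall_eq]
    refine ⟨?_, by simp⟩
    rw [s2, r2]
    exact Finset.disjoint_sdiff

theorem cut_sub {G : Clus β} (h : Good U1 U2 G) {A R : Finset β} (hA : IsBlock G A)
    (hs : (∃ B, G = {B}) ∨ grd G ⊆ R) :
    ∀ H ∈ [({A} : Clus β), Phylo.restr G (grd G \ A)], (∃ B, H = {B}) ∨ grd H ⊆ R := by
  obtain ⟨r1, r2⟩ := h.rmb hA
  intro H hH
  simp only [List.mem_cons, List.not_mem_nil, or_false] at hH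
  rcases hH with rfl | rfl
  · exact Or.inl ⟨A, rfl⟩
  · right
    rw [r2]
    rcases hs with ⟨B, rfl⟩ | hs
    · have : A = B := Finset.mem_singleton.1 hA.1
      subst this
      have e : grd ({A} : Clus β) = A := by simp [grd]
      rw [e]; simp
    · exact Finset.sdiff_subset.trans hs

theorem inv_cut {s t : St β} {A C : Finset β} (h : Inv U1 U2 s) (ha : CutApply s A C t) :
    Inv U1 U2 t := by
  obtain ⟨-, G, F', M', hG, hA, hR, hM, rfl⟩ := ha
  have gG := h.gF G hG
  obtain ⟨n1, n2⟩ := cut_new gG hA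
  obtain ⟨f1, f2, f3, -, -⟩ := repl_spec hR h.gF h.dis n1 n2
  have hsub : ∀ H ∈ F', (∃ B, H = {B}) ∨ grd H ⊆ grd s.1 := by
    intro H hH
    rcases f3 H hH with h1 | h1
    · exact cut_sub gG hA (h.sub G hG) H h1
    · exact h.sub H h1.1
  have hold : ∀ S, Bot s.2.2 S → ∀ H ∈ F', S ⊆ grd H → Supp U1 U2 (grd H) S := by
    intro S hS H hH hSH
    rcases f3 H hH with h1 | h1
    · exact (h.mb S hS G hG (hSH.trans (n1 H h1).2)).mono hSH (n1 H h1).2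
    · exact h.mb S hS H h1.1 hSH
  rcases hM with ⟨P, D, c1, c2, c3, c4, c5, rfl⟩ | ⟨-, rfl⟩
  · refine ⟨h.gR, f1, f2, hsub, mok_remapBot h.m, ?_⟩
    intro S hS H hH hSH
    rcases bot_remapBot hS with h1 | rfl
    · exact hold S h1 H hH hSH
    · rcases f3 H hH with h1 | h1
      · simp only [List.mem_cons, List.not_mem_nil, or_false] at h1
        have hdj := gG.blk2 c5 hA c3
        rcases h1 with rfl | rfl
        · have e : grd ({A} : Clus β) = A := by simp [grd]
          rw [e] at hSH
          exact absurd hdj (not_sub_disj (gG.ne S c5.1) subset_rfl hSH)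
        · rw [(gG.rmb hA).2]
          have hnb : ¬ IsBlock G P := fun hb => c1.2.2.1.ne (hb.2 A hA.1 c1.2.2.1.1)
          have h3 := ((gG.sup P c1.2.1).resolve_left hnb).inter (grd G \ A)
          rw [Finset.inter_eq_right.2 Finset.sdiff_subset] at h3
          convert h3 using 1
          ext x
          simp only [Finset.mem_inter, Finset.mem_sdiff]
          constructor
          · intro hx
            exact ⟨c2.2.2.1.1 hx, sub_grd c2.1 hx, Finset.disjoint_left.1 hdj hx⟩
          · rintro ⟨hx, -, hx2⟩
            obtain ⟨E, hE, hxE⟩ := gG.kid c1 hx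
            rcases c4 E hE with rfl | rfl
            · exact absurd hxE hx2
            · exact hxE
      · exact absurd h1.2 (not_sub_disj (gG.ne S c5.1) hSH (sub_grd c5.1))
  · exact ⟨h.gR, f1, f2, hsub, h.m, hold⟩

theorem inv_pend {s t : St β} {A C : Finset β} (h : Inv U1 U2 s) (ha : PendApply s A C t) :
    Inv U1 U2 t := by
  obtain ⟨⟨⟨hne, -⟩, -⟩, G, new, F', M', hG, hA, hC, hcp, hR, hM, rfl⟩ := ha
  have gG := h.gF G hG
  obtain ⟨n1, n2, n3⟩ := cutPend_spec gG hA hC hcp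
  obtain ⟨f1, f2, f3, -, -⟩ := repl_spec hR h.gF h.dis n1 n2
  obtain ⟨PA, PC, L, p1, p2, p3, rfl⟩ := hM
  have gsub : grd G ⊆ grd s.1 := (h.sub G hG).resolve_left (not_single hA.1 hC.1 hne)
  have aux : ∀ S, IsBlock G S → S ⊆ A ∪ C → Supp U1 U2 (grd G \ (L \ (A ∪ C))) S →
      ∀ H ∈ F', S ⊆ grd H → Supp U1 U2 (grd H) S := by
    intro S hS hSu hsup H hH hSH
    rcases f3 H hH with h1 | h1
    · rcases n3 L p3 H h1 with h2 | h2
      · rw [h2]; exact hsup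
      · exact absurd h2 (not_sub_disj (gG.ne S hS.1) hSu hSH)
    · exact absurd h1.2 (not_sub_disj (gG.ne S hS.1) hSH (sub_grd hS.1))
  refine ⟨h.gR, f1, f2, ?_, mok_remapIf (mok_remapIf h.m), ?_⟩
  · intro H hH
    rcases f3 H hH with h1 | h1
    · exact Or.inr ((n1 H h1).2.trans gsub)
    · exact h.sub H h1.1
  · intro S hS H hH hSH
    rcases bot_remapIf hS with h1 | ⟨rfl, h1⟩
    · rcases bot_remapIf h1 with h1 | ⟨rfl, h2⟩
      · rcases f3 H hH with h2 | h2
        · exact (h.mb S h1 G hG (hSH.trans (n1 H h2).2)).mono hSH (n1 H h2).2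
        · exact h.mb S h1 H h2.1 hSH
      · refine aux S hC Finset.subset_union_right ?_ H hH hSH
        rw [Finset.union_comm] at p3 ⊢
        exact pend_supp gG hC hA hne.symm p3 p2 h2
    · exact aux S hA Finset.subset_union_left (pend_supp gG hA hC hne p3 p1 h1) H hH hSH

theorem child_uniq {G : Clus β} (h : Good U1 U2 G) {A P P' : Finset β} (h1 : IsChild G A P)
    (h2 : IsChild G A P') : P = P' :=
  (h.par h1 h2.2.1 h2.2.2.1).antisymm (h.par h2 h1.2.1 h1.2.2.1)

theorem two_supp {G : Clus β} (h : Good U1 U2 G) {A C P : Finset β} (hA : IsChild G A P)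
    (hC : IsChild G C P) (hne : A ≠ C) (hd : ¬ Deg3 G P) : Supp U1 U2 (grd G) (A ∪ C) := by
  rw [← h.two hA hC hne hd]
  refine (h.sup P hA.2.1).resolve_left ?_
  intro hb
  exact hA.2.2.1.ne (hb.2 A hA.1 hA.2.2.1.1)

theorem inv_con {s t : St β} {A C : Finset β} (h : Inv U1 U2 s) (ha : ConApply s A C t) :
    Inv U1 U2 t := by
  obtain ⟨⟨⟨hne, P, hAP, hCP, hall⟩, -⟩, G, F', hG, ⟨-, bA, bC, Q, hAQ, hCQ⟩, hR,
    PR, PG, hPR, hPG, b, hb, rfl⟩ := ha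
  have gG := h.gF G hG
  obtain rfl := child_uniq h.gR hAP hPR
  obtain rfl := child_uniq gG hAQ hPG
  obtain ⟨r1, r2⟩ := h.gR.con hAP hCP (hall A hAP) (hall C hCP)
  obtain ⟨g1, g2⟩ := gG.con hAQ hCQ bA bC
  obtain ⟨f1, f2, f3, -, -⟩ := repl_spec hR h.gF h.dis
    (by intro H hH; rw [List.mem_singleton] at hH; subst hH; exact ⟨g1, g2.le⟩) (by simp)
  have gsub : grd G ⊆ grd s.1 := (h.sub G hG).resolve_left (not_single bA.1 bC.1 hne)
  refine ⟨r1, f1, f2, ?_, ?_, ?_⟩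
  · intro H hH
    change _ ∨ grd H ⊆ grd (conCh s.1 A C)
    rw [r2]
    rcases f3 H hH with h1 | h1
    · rw [List.mem_singleton] at h1; subst h1; right; rw [g2]; exact gsub
    · exact h.sub H h1.1
  · intro S X1 X2 b' hS
    change Function.update s.2.2 (A ∪ C) (some (A, C, b)) S = _ at hS
    by_cases e : S = A ∪ C
    · subst e
      rw [Function.update_self] at hS
      simp only [Option.some.injEq, Prod.mk.injEq] at hS
      obtain ⟨rfl, rfl, rfl⟩ := hS
      exact ⟨gG.ne _ bA.1, gG.ne _ bC.1, gG.blk2 bA bC hne, rfl⟩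
    · rw [Function.update_of_ne e] at hS
      exact h.m S _ _ _ hS
  · rintro S ⟨X1, X2, hS⟩ H hH hSH
    change Function.update s.2.2 (A ∪ C) (some (A, C, b)) S = _ at hS
    by_cases e : S = A ∪ C
    · subst e
      rw [Function.update_self] at hS
      simp only [Option.some.injEq, Prod.mk.injEq] at hS
      obtain ⟨rfl, rfl, rfl⟩ := hS
      have hACG : A ∪ C ⊆ grd G := Finset.union_subset (sub_grd bA.1) (sub_grd bC.1)
      rcases f3 H hH with h1 | h1
      · rw [List.mem_singleton] at h1; subst h1
        rw [g2]
        have hnd : ¬ (Deg3 s.1 P ∧ Deg3 G Q) := fun hc => by simpa using hb.2 hc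
        by_cases hd : Deg3 s.1 P
        · exact two_supp gG hAQ hCQ hne (fun hc => hnd ⟨hd, hc⟩)
        · exact (two_supp h.gR hAP hCP hne hd).mono hACG gsub
      · exact absurd h1.2 (not_sub_disj
          ((gG.ne A bA.1).mono Finset.subset_union_left) hSH hACG)
    · rw [Function.update_of_ne e] at hS
      rcases f3 H hH with h1 | h1
      · rw [List.mem_singleton] at h1; subst h1
        rw [g2] at hSH ⊢
        exact h.mb S ⟨_, _, hS⟩ G hG hSH
      · exact h.mb S ⟨_, _, hS⟩ H h1.1 hSH

theorem inv_cutB {s : St β} {B : Finset β} {F' : List (Clus β)} (h : Inv U1 U2 s)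
    (ha : CutB B s.2.1 F') :
    Inv U1 U2 (s.1, F', s.2.2) ∧ ({B} : Clus β) ∈ F' ∧
      ∀ B', ({B'} : Clus β) ∈ s.2.1 → ({B'} : Clus β) ∈ F' := by
  obtain ⟨G, hG, hB, hR⟩ := ha
  have gG := h.gF G hG
  obtain ⟨n1, n2⟩ := cut_new gG hB
  obtain ⟨f1, f2, f3, f4, f5⟩ := repl_spec hR h.gF h.dis n1 n2
  refine ⟨⟨h.gR, f1, f2, ?_, h.m, ?_⟩, f4 _ (by simp), ?_⟩
  · intro H hH
    rcases f3 H hH with h1 | h1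
    · exact cut_sub gG hB (h.sub G hG) H h1
    · exact h.sub H h1.1
  · intro S hS H hH hSH
    rcases f3 H hH with h1 | h1
    · exact (h.mb S hS G hG (hSH.trans (n1 H h1).2)).mono hSH (n1 H h1).2
    · exact h.mb S hS H h1.1 hSH
  · intro B' hB'
    rcases f5 _ hB' with h1 | h1
    · subst h1
      have : B = B' := Finset.mem_singleton.1 hB.1
      subst this
      exact f4 _ (by simp)
    · exact h1

theorem inv_cuts {l : List (Finset β)} {F F' : List (Clus β)} (hc : CutsList l F F') :
    ∀ {R : Clus β} {M : MapT β}, Inv U1 U2 (R, F, M) →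
    Inv U1 U2 (R, F', M) ∧ (∀ B ∈ l, ({B} : Clus β) ∈ F') ∧
      ∀ B', ({B'} : Clus β) ∈ F → ({B'} : Clus β) ∈ F' := by
  induction hc with
  | nil F => intro R M h; exact ⟨h, by simp, fun _ h => h⟩
  | cons B l F F1 F' h1 _ ih =>
    intro R M h
    obtain ⟨a1, a2, a3⟩ := inv_cutB (s := (R, F, M)) h h1
    obtain ⟨b1, b2, b3⟩ := ih a1
    refine ⟨b1, ?_, fun B' hB' => b3 B' (a3 B' hB')⟩
    intro B' hB'
    rcases List.mem_cons.1 hB' with rfl | hB'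
    · exact b3 _ a2
    · exact b2 _ hB'

theorem mem_foldr_union {l : List (Finset β)} {x : β} :
    x ∈ l.foldr (· ∪ ·) ∅ ↔ ∃ B ∈ l, x ∈ B := by
  induction l with
  | nil => simp
  | cons a l ih => simp [ih]

theorem bot_fold {l : List (Finset β)} {M : MapT β} (h : MOk M) :
    MOk (l.foldr (fun B M => remapBot M B) M) ∧
    ∀ S, Bot (l.foldr (fun B M => remapBot M B) M) S → Bot M S ∨ S ∈ l := by
  induction l with
  | nil => exact ⟨h, fun S hS => Or.inl hS⟩
  | cons a l ih =>
    refine ⟨mok_remapBot ih.1, ?_⟩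
    intro S hS
    rcases bot_remapBot hS with h1 | h1
    · rcases ih.2 S h1 with h2 | h2
      · exact Or.inl h2
      · exact Or.inr (List.mem_cons_of_mem _ h2)
    · exact Or.inr (by simp [h1])

theorem inv_prep {s t : St β} {A C : Finset β} (h : Inv U1 U2 s) (ha : Prep s A C t) :
    Inv U1 U2 t := by
  obtain ⟨l, -, hl, F', hc, rfl⟩ := ha
  obtain ⟨i1, i2, -⟩ := inv_cuts hc (R := s.1) (M := s.2.2) h
  have hbl : ∀ B ∈ l, IsBlock s.1 B := fun B hB => ((hl B).1 hB).1.1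
  obtain ⟨m1, m2⟩ := bot_fold (l := l) h.m
  have hbc : BC s.1 (grd s.1 \ l.foldr (· ∪ ·) ∅) := by
    refine BC.sdiff (fun B hB => Or.inl (sub_grd hB.1)) ?_
    intro B hB
    by_cases e : B ∈ l
    · left; intro x hx; exact mem_foldr_union.2 ⟨B, e, hx⟩
    · right
      rw [Finset.disjoint_left]
      intro x hx hx'
      obtain ⟨B', hB', hxB'⟩ := mem_foldr_union.1 hx'
      have hne : B ≠ B' := by rintro rfl; exact e hB'
      exact Finset.disjoint_left.1 (h.gR.blk2 hB (hbl B' hB') hne) hx hxB'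
  obtain ⟨r1, r2⟩ := h.gR.restr _ hbc
  have hs : ∀ B : Finset β, grd ({B} : Clus β) = B := by intro B; simp [grd]
  refine ⟨r1, i1.gF, i1.dis, ?_, m1, ?_⟩
  · intro G hG
    change _ ∨ grd G ⊆ grd (Phylo.restr s.1 (grd s.1 \ l.foldr (· ∪ ·) ∅))
    rcases i1.sub G hG with h1 | h1
    · exact Or.inl h1
    by_cases hsg : ∃ B, G = {B}
    · exact Or.inl hsg
    right
    rw [r2, Finset.inter_eq_right.2 Finset.sdiff_subset, Finset.subset_sdiff]
    refine ⟨h1, ?_⟩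
    rw [Finset.disjoint_left]
    intro x hx hx'
    obtain ⟨B, hB, hxB⟩ := mem_foldr_union.1 hx'
    rcases pw_disj i1.dis hG (i2 B hB) with h2 | h2
    · exact hsg ⟨B, h2⟩
    · rw [hs] at h2; exact Finset.disjoint_left.1 h2 hx hxB
  · intro S hS G hG hSG
    rcases m2 S hS with h1 | h1
    · exact i1.mb S h1 G hG hSG
    · rcases pw_disj i1.dis hG (i2 S h1) with h2 | h2
      · subst h2; rw [hs]; exact Or.inl rfl
      · rw [hs] at h2
        exact absurd h2 (not_sub_disj (h.gR.ne S (hbl S h1).1) hSG subset_rfl)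

theorem inv_step {k : ℕ} {s t : St β} (h : Inv U1 U2 s) (ha : AMFSStep k s t) :
    Inv U1 U2 t := by
  obtain ⟨-, -, ⟨A, ha⟩ | ⟨-, A, C, s0, -, hp, ha⟩⟩ := ha
  · exact inv_isol h ha
  · have h0 : Inv U1 U2 s0 := by
      rcases hp with ⟨-, rfl⟩ | ⟨-, hp⟩
      · exact h
      · exact inv_prep h hp
    rcases ha with ha | ha | ha
    · exact inv_con h0 ha
    · exact inv_cut h0 ha
    · exact inv_pend h0 ha

/-! Expansion -/

structure EOk (U1 U2 G : Clus β) (M : MapT β) : Prop where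
  cov : ∀ x ∈ grd G, ∃ A, IsBlock G A ∧ x ∈ A
  sup : ∀ C ∈ G, IsBlock G C ∨ Supp U1 U2 (grd G) C
  bd : ∀ A C, IsBlock G A → IsBlock G C → A = C ∨ Disjoint A C
  mb : ∀ S, Bot M S → S ⊆ grd G → Supp U1 U2 (grd G) S

theorem eok_step {G : Clus β} {M : MapT β} (hM : MOk M) (h : EOk U1 U2 G M)
    {A X1 X2 : Finset β} {b : Bool} (hA : IsBlock G A) (hm : M A = some (X1, X2, b)) :
    EOk U1 U2 (if b then insert X1 (insert X2 (G.erase A)) else insert X1 (insert X2 G)) M := by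
  obtain ⟨ne1, ne2, hd, hAe⟩ := hM A X1 X2 b hm
  set G' := (if b then insert X1 (insert X2 (G.erase A)) else insert X1 (insert X2 G)) with hG'
  have s1 : X1 ⊆ A := hAe ▸ Finset.subset_union_left
  have s2 : X2 ⊆ A := hAe ▸ Finset.subset_union_right
  have n1 : ¬ A ⊆ X1 := fun hc => not_sub_disj ne2 (s2.trans hc) subset_rfl hd
  have n2 : ¬ A ⊆ X2 := fun hc => not_sub_disj ne1 subset_rfl (s1.trans hc) hd
  have hmem : ∀ E, E ∈ G' → E = X1 ∨ E = X2 ∨ (E ∈ G ∧ (E = A → b = false)) := by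
    intro E hE
    rw [hG'] at hE
    cases b
    · simp at hE; tauto
    · simp at hE; tauto
  have hm1 : X1 ∈ G' := by rw [hG']; cases b <;> simp
  have hm2 : X2 ∈ G' := by rw [hG']; cases b <;> simp
  have hm3 : ∀ E ∈ G, E ≠ A → E ∈ G' := by
    intro E hE e; rw [hG']; cases b <;> simp [hE, e]
  have b1 : IsBlock G' X1 := by
    refine ⟨hm1, ?_⟩
    intro E hE hs
    rcases hmem E hE with rfl | rfl | ⟨h1, -⟩
    · rfl
    · exact absurd hd (not_sub_disj ne2 hs subset_rfl)
    · exact absurd ((hA.2 E h1 (hs.trans s1)) ▸ hs) n1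
  have b2 : IsBlock G' X2 := by
    refine ⟨hm2, ?_⟩
    intro E hE hs
    rcases hmem E hE with rfl | rfl | ⟨h1, -⟩
    · exact absurd hd (not_sub_disj ne1 subset_rfl hs)
    · rfl
    · exact absurd ((hA.2 E h1 (hs.trans s2)) ▸ hs) n2
  have b3 : ∀ B, IsBlock G B → B ≠ A → IsBlock G' B := by
    intro B hB e
    have hBA := (h.bd B A hB hA).resolve_left e
    refine ⟨hm3 B hB.1 e, ?_⟩
    intro E hE hs
    rcases hmem E hE with rfl | rfl | ⟨h1, -⟩
    · exact absurd hBA (not_sub_disj ne1 hs s1)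
    · exact absurd hBA (not_sub_disj ne2 hs s2)
    · exact hB.2 E h1 hs
  have hg : grd G' = grd G := by
    ext x
    rw [mem_grd', mem_grd']
    constructor
    · rintro ⟨E, hE, hx⟩
      rcases hmem E hE with rfl | rfl | ⟨h1, -⟩
      · exact ⟨A, hA.1, s1 hx⟩
      · exact ⟨A, hA.1, s2 hx⟩
      · exact ⟨E, h1, hx⟩
    · rintro ⟨E, hE, hx⟩
      by_cases e : E = A
      · rw [e, hAe, Finset.mem_union] at hx
        rcases hx with hx | hx
        · exact ⟨X1, hm1, hx⟩
        · exact ⟨X2, hm2, hx⟩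
      · exact ⟨E, hm3 E hE e, hx⟩
  -- classification of new blocks
  have bcl : ∀ B, IsBlock G' B → B = X1 ∨ B = X2 ∨ (IsBlock G B ∧ B ≠ A) := by
    intro B hB
    rcases hmem B hB.1 with h1 | h1 | ⟨h1, -⟩
    · exact Or.inl h1
    · exact Or.inr (Or.inl h1)
    · by_cases hAB : A ⊆ B
      · exact Or.inl (hB.2 X1 hm1 (s1.trans hAB)).symm
      · refine Or.inr (Or.inr ⟨⟨h1, ?_⟩, fun e => hAB e.ge⟩)
        intro E hE hs
        by_cases e : E = A
        · exact absurd (e ▸ hs) hAB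
        · exact hB.2 E (hm3 E hE e) hs
  have dA : ∀ B, IsBlock G B → B ≠ A → Disjoint A B := fun B hB e =>
    ((h.bd B A hB hA).resolve_left e).symm
  refine ⟨?_, ?_, ?_, ?_⟩
  · intro x hx
    rw [hg] at hx
    obtain ⟨B, hB, hxB⟩ := h.cov x hx
    by_cases e : B = A
    · rw [e, hAe, Finset.mem_union] at hxB
      rcases hxB with hx | hx
      · exact ⟨X1, b1, hx⟩
      · exact ⟨X2, b2, hx⟩
    · exact ⟨B, b3 B hB e, hxB⟩
  · intro E hE
    rw [hg]
    rcases hmem E hE with rfl | rfl | ⟨h1, hb⟩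
    · exact Or.inl b1
    · exact Or.inl b2
    · by_cases e : E = A
      · right
        subst e
        rw [hb rfl] at hm
        exact h.mb E ⟨_, _, hm⟩ (sub_grd h1)
      · rcases h.sup E h1 with h2 | h2
        · exact Or.inl (b3 E h2 e)
        · exact Or.inr h2
  · intro B C hB hC
    rcases bcl B hB with rfl | rfl | ⟨p, p'⟩ <;> rcases bcl C hC with rfl | rfl | ⟨q, q'⟩
    · exact Or.inl rfl
    · exact Or.inr hd
    · exact Or.inr ((dA C q q').mono_left s1)
    · exact Or.inr hd.symm
    · exact Or.inl rfl
    · exact Or.inr ((dA C q q').mono_left s2)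
    · exact Or.inr ((dA B p p').mono_left s1).symm
    · exact Or.inr ((dA B p p').mono_left s2).symm
    · exact h.bd B C p q
  · rw [hg]; exact h.mb

theorem eok_expand {M : MapT β} (hM : MOk M) {F F' : List (Clus β)}
    (h : ∀ G ∈ F, EOk U1 U2 G M) (he : ExpandStep M F F') : ∀ G ∈ F', EOk U1 U2 G M := by
  obtain ⟨G, A, X1, X2, b, hA, hm, l1, l2, rfl, rfl⟩ := he
  intro H hH
  rcases List.mem_append.1 hH with hH | hH
  · rcases List.mem_append.1 hH with hH | hH
    · exact h H (by simp [hH])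
    · rw [List.mem_singleton] at hH
      subst hH
      exact eok_step hM (h G (by simp)) hA hm
  · exact h H (by simp [hH])

theorem eok_final {G : Clus β} {M : MapT β} (h : EOk U1 U2 G M) {C : Finset β} (hC : C ∈ G)
    (hr : C ≠ grd G) (hb : ¬ IsBlock G C)
    (h1 : Refines (G.erase C) (restr U1 (grd (G.erase C))))
    (h2 : Refines (G.erase C) (restr U2 (grd (G.erase C)))) : False := by
  have hne : C ≠ ∅ := by
    rintro rfl
    exact hb ⟨hC, fun D _ hD => Finset.subset_empty.1 hD⟩
  have hg : grd (G.erase C) = grd G := by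
    ext x
    constructor
    · intro hx
      obtain ⟨E, hE, hx⟩ := mem_grd'.1 hx
      exact sub_grd (Finset.mem_of_mem_erase hE) hx
    · intro hx
      obtain ⟨B, hB, hxB⟩ := h.cov x hx
      exact sub_grd (Finset.mem_erase.2 ⟨fun (e : B = C) => hb (e ▸ hB), hB.1⟩) hxB
  rw [hg] at h1 h2
  rcases (h.sup C hC).resolve_left hb with h3 | ⟨D, hD, h3⟩ | ⟨D, hD, h3⟩
  · exact hr h3
  · refine Finset.notMem_erase C G (h1.1 ?_)
    unfold restr
    exact Finset.mem_erase.2 ⟨hne, Finset.mem_image.2 ⟨D, hD, h3.symm⟩⟩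
  · refine Finset.notMem_erase C G (h2.1 ?_)
    unfold restr
    exact Finset.mem_erase.2 ⟨hne, Finset.mem_image.2 ⟨D, hD, h3.symm⟩⟩

/-- Every agreement forest reported by allMulMAFs* is
relevant: contracting any edge destroys the agreement-forest property. -/
theorem allMulMAFsStar_output_is_relevant
    {β : Type} [DecidableEq β] (X : Finset β) (ρ : β) (hρ : ρ ∉ X)
    (T1 T2 : Clus β) (h1 : IsPhylo X T1) (h2 : IsPhylo X T2) (k : ℕ) (F : List (Clus β))
    (h : AMFSRun T1 T2 ρ k F) :
    ∀ F', ContractEdgeF F F' → ¬ IsAF X ρ T1 T2 F' := by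
  rintro F' ⟨l1, G, l2, C, rfl, hC, hr, hb, rfl⟩ hAF
  obtain ⟨s, hrun, -, -, hexp, -⟩ := h
  obtain ⟨a1, a2⟩ := good_aug (U1 := aug T1 ρ) (U2 := aug T2 ρ) hρ h1 (Or.inl subset_rfl)
  obtain ⟨b1, b2⟩ := good_aug (U1 := aug T1 ρ) (U2 := aug T2 ρ) hρ h2 (Or.inr subset_rfl)
  have hinit : Inv (aug T1 ρ) (aug T2 ρ) (initSt T1 T2 ρ) := by
    refine ⟨a1, ?_, ?_, ?_, ?_, ?_⟩
    · intro H hH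
      have : H = aug T2 ρ := by simpa [initSt] using hH
      rw [this]; exact b1
    · simp [initSt]
    · intro H hH
      have : H = aug T2 ρ := by simpa [initSt] using hH
      right
      change grd H ⊆ grd (aug T1 ρ)
      rw [this, a2, b2]
    · intro S X1 X2 b hS; simp [initSt] at hS
    · rintro S ⟨X1, X2, hS⟩; simp [initSt] at hS
  have hs : Inv (aug T1 ρ) (aug T2 ρ) s := by
    clear hexp
    induction hrun with
    | refl => exact hinit
    | tail _ hst ih => exact inv_step ih hst
  have he : ∀ G ∈ s.2.1, EOk (aug T1 ρ) (aug T2 ρ) G s.2.2 := by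
    intro H hH
    have g := hs.gF H hH
    refine ⟨g.cov, g.sup, ?_, fun S hS hSH => hs.mb S hS H hH hSH⟩
    intro A B hA hB
    by_cases e : A = B
    · exact Or.inl e
    · exact Or.inr (g.blk2 hA hB e)
  have hf : ∀ H ∈ l1 ++ G :: l2, EOk (aug T1 ρ) (aug T2 ρ) H s.2.2 := by
    generalize l1 ++ G :: l2 = out at hexp
    induction hexp with
    | refl => exact he
    | tail _ hst ih => exact eok_expand hs.m ih hst
  obtain ⟨-, -, -, href, -⟩ := hAF
  obtain ⟨r1, r2⟩ := href (G.erase C) (by simp)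
  exact eok_final (hf G (by simp)) hC hr hb r1 r2

end Phylo
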